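/- Emptiness, finiteness, inclusion, and equivalence are decidable for reversible deterministic two-party Watson-Crick systems whose number of communications is bounded by a constant k. -/

import Mathlib

namespace WK

/-- Tape symbols: input symbols plus the two endmarkers.
`Sum.inr false` is the left endmarker, `Sum.inr true` the right endmarker. -/
abbrev TSym (α : Type) : Type := α ⊕ Bool

/-- The tape for input `w`: left endmarker, the symbols of `w`, right endmarker. -/
def tape {α : Type} (w : List α) (k : ℕ) : TSym α :=
  ((Sum.inr false :: w.map Sum.inl) ++ [Sum.inr true]).getD k (Sum.inr true)

/-- A deterministic two-party Watson-Crick system: two finite automata (the upper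
component `1` and the lower component `2`) with a finite set `M` of messages,
partial transition functions `δᵢ` (depending on state, scanned symbol and received
message, `none` = no message) and broadcast functions `μᵢ`. -/
structure DPWK (α : Type) where
  M : Type
  Q1 : Type
  Q2 : Type
  fM : Fintype M
  fQ1 : Fintype Q1
  fQ2 : Fintype Q2
  δ1 : Q1 → TSym α → Option M → Option (Q1 × Bool)
  δ2 : Q2 → TSym α → Option M → Option (Q2 × Bool)
  μ1 : Q1 → TSym α → Option M
  μ2 : Q2 → TSym α → Option M
  q01 : Q1
  q02 : Q2
  F1 : Set Q1
  F2 : Set Q2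

/-- A configuration: states and head positions of the two components. -/
structure Config {α : Type} (A : DPWK α) where
  p : A.Q1
  i : ℕ
  q : A.Q2
  j : ℕ

/-- One synchronous (forward) computation step: each component reads its symbol,
receives the message broadcast by the other component, changes its state and
optionally moves (the upper head to the right, the lower head to the left). -/
def Step {α : Type} (A : DPWK α) (w : List α) (c c' : Config A) : Prop :=
  ∃ d1 d2 : Bool,
    A.δ1 c.p (tape w c.i) (A.μ2 c.q (tape w c.j)) = some (c'.p, d1) ∧
    A.δ2 c.q (tape w c.j) (A.μ1 c.p (tape w c.i)) = some (c'.q, d2) ∧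
    c'.i = c.i + (cond d1 1 0) ∧ c.j = c'.j + (cond d2 1 0)

/-- The initial configuration on input `w`: the upper component on the left
endmarker, the lower component on the right endmarker. -/
def initConf {α : Type} (A : DPWK α) (w : List α) : Config A :=
  ⟨A.q01, 0, A.q02, w.length + 1⟩

/-- The system halts in `c` if no successor configuration exists. -/
def Halted {α : Type} (A : DPWK α) (w : List α) (c : Config A) : Prop :=
  ¬ ∃ c', Step A w c c'

/-- A configuration is accepting if at least one component is in an accepting state. -/
def AccConf {α : Type} (A : DPWK α) (c : Config A) : Prop :=
  c.p ∈ A.F1 ∨ c.q ∈ A.F2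

/-- `cs` is an accepting computation of `A` on `w`: it starts in the initial
configuration, follows the step relation, and ends in a halting configuration
with at least one component in an accepting state. -/
def AccComp {α : Type} (A : DPWK α) (w : List α) (cs : List (Config A)) : Prop :=
  cs.head? = some (initConf A w) ∧ List.Chain' (Step A w) cs ∧
    ∃ c, cs.getLast? = some c ∧ Halted A w c ∧ AccConf A c

def Accepts {α : Type} (A : DPWK α) (w : List α) : Prop := ∃ cs, AccComp A w cs

/-- The language accepted by `A`. -/
def lang {α : Type} (A : DPWK α) : Set (List α) := { w | Accepts A w }

/-- One backward computation step, induced by reverse transition functions `δ'ᵢ` and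
reverse broadcast functions `μ'ᵢ`: the heads first move to their predecessor
positions (the upper head left, the lower head right) and then read the symbols there. -/
def BackStep {α : Type} (A : DPWK α)
    (δ'1 : A.Q1 → TSym α → Option A.M → Option (A.Q1 × Bool))
    (δ'2 : A.Q2 → TSym α → Option A.M → Option (A.Q2 × Bool))
    (μ'1 : A.Q1 → TSym α → Option A.M)
    (μ'2 : A.Q2 → TSym α → Option A.M)
    (w : List α) (c' c : Config A) : Prop :=
  ∃ d1 d2 : Bool,
    δ'1 c'.p (tape w c.i) (μ'2 c'.q (tape w c.j)) = some (c.p, d1) ∧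
    δ'2 c'.q (tape w c.j) (μ'1 c'.p (tape w c.i)) = some (c.q, d2) ∧
    c'.i = c.i + (cond d1 1 0) ∧ c.j = c'.j + (cond d2 1 0)

/-- A witness of reversibility: reverse transition and broadcast functions whose
induced backward step relation is exactly the inverse of the forward step relation,
so every configuration has at most one predecessor, computable by such a system. -/
structure RevWitness {α : Type} (A : DPWK α) where
  δ'1 : A.Q1 → TSym α → Option A.M → Option (A.Q1 × Bool)
  δ'2 : A.Q2 → TSym α → Option A.M → Option (A.Q2 × Bool)
  μ'1 : A.Q1 → TSym α → Option A.M
  μ'2 : A.Q2 → TSym α → Option A.M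
  inverse : ∀ (w : List α) (c c' : Config A),
    BackStep A δ'1 δ'2 μ'1 μ'2 w c' c ↔ Step A w c c'

/-- A reversible deterministic two-party Watson-Crick system (REV-PWK). -/
def Reversible {α : Type} (A : DPWK α) : Prop := Nonempty (RevWitness A)

/-- Number of messages (`0`, `1` or `2`) broadcast in one step from configuration `c`,
with respect to broadcast functions `μ1`, `μ2`. -/
def stepMsgs {α : Type} (A : DPWK α)
    (μ1 : A.Q1 → TSym α → Option A.M) (μ2 : A.Q2 → TSym α → Option A.M)
    (w : List α) (c : Config A) : ℕ :=
  ((μ1 c.p (tape w c.i)).elim 0 fun _ => 1) + ((μ2 c.q (tape w c.j)).elim 0 fun _ => 1)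

/-- Total number of messages sent during the computation `cs` (no messages are
sent from the final, halting configuration). -/
def commCount {α : Type} (A : DPWK α)
    (μ1 : A.Q1 → TSym α → Option A.M) (μ2 : A.Q2 → TSym α → Option A.M)
    (w : List α) (cs : List (Config A)) : ℕ :=
  (cs.dropLast.map (stepMsgs A μ1 μ2 w)).sum

/-- `A` is a reversible system that is communication bounded by `f`: it is reversible
and every word of its language is accepted by a computation in which the number of
messages sent in the forward computation and in the reverse computation are each at
most `f` of the input length. -/
def RevCommBounded {α : Type} (A : DPWK α) (f : ℕ → ℕ) : Prop :=
  ∃ Wit : RevWitness A, ∀ w ∈ lang A, ∃ cs, AccComp A w cs ∧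
    commCount A A.μ1 A.μ2 w cs ≤ f w.length ∧
    commCount A Wit.μ'1 Wit.μ'2 w cs.reverse ≤ f w.length

/-- `A` (not necessarily reversible) is communication bounded by `f`. -/
def CommBounded {α : Type} (A : DPWK α) (f : ℕ → ℕ) : Prop :=
  ∀ w ∈ lang A, ∃ cs, AccComp A w cs ∧ commCount A A.μ1 A.μ2 w cs ≤ f w.length

/-- The family of languages accepted by reversible deterministic two-party
Watson-Crick systems over the alphabet `α`. -/
def RevPWKLangs (α : Type) : Set (Set (List α)) :=
  { L | ∃ A : DPWK α, Reversible A ∧ lang A = L }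

/-- Languages accepted by REV-PWKs with `O(f)` communication. -/
def RevPWKLangsO (α : Type) (f : ℕ → ℕ) : Set (Set (List α)) :=
  { L | ∃ (A : DPWK α) (C : ℕ),
      RevCommBounded A (fun n => C * f n + C) ∧ lang A = L }

/-- Languages accepted by (possibly irreversible) DPWKs with `O(f)` communication. -/
def PWKLangsO (α : Type) (f : ℕ → ℕ) : Set (Set (List α)) :=
  { L | ∃ (A : DPWK α) (C : ℕ),
      CommBounded A (fun n => C * f n + C) ∧ lang A = L }

end WK

namespace WK

/-- A finite description of a two-party Watson-Crick system over the binary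
alphabet `Bool`:
`((m, n1, n2), (t1, t2), (u1, u2), (i1, i2), (f1, f2))` where the message set is
`Fin (m+1)`, the state sets are `Fin (n1+1)` and `Fin (n2+1)`, `t1, t2` are the
transition tables, `u1, u2` the broadcast tables, `i1, i2` the initial states and
`f1, f2` the accepting states. This type is `Primcodable`, so descriptions can be
encoded as natural numbers. -/
abbrev Desc : Type :=
  (ℕ × ℕ × ℕ) × (List (Option (ℕ × Bool)) × List (Option (ℕ × Bool))) ×
    (List (Option ℕ) × List (Option ℕ)) × (ℕ × ℕ) × (List ℕ × List ℕ)

/-- Index of a tape symbol over `Bool`. -/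
def symIdx : TSym Bool → ℕ
  | Sum.inl false => 0
  | Sum.inl true => 1
  | Sum.inr false => 2
  | Sum.inr true => 3

/-- Index of an optional message. -/
def msgIdx {m : ℕ} : Option (Fin m) → ℕ
  | none => 0
  | some x => x.val + 1

def toFin (n x : ℕ) : Fin (n + 1) := ⟨x % (n + 1), Nat.mod_lt _ (Nat.succ_pos n)⟩

/-- The two-party Watson-Crick system described by a description. -/
def toDPWK : Desc → DPWK Bool
  | ((m, n1, n2), (t1, t2), (u1, u2), (i1, i2), (f1, f2)) =>
    { M := Fin (m + 1)
      Q1 := Fin (n1 + 1)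
      Q2 := Fin (n2 + 1)
      fM := inferInstance
      fQ1 := inferInstance
      fQ2 := inferInstance
      δ1 := fun q s msg =>
        (t1.getD ((q.val * 4 + symIdx s) * (m + 2) + msgIdx msg) none).map
          fun e => (toFin n1 e.1, e.2)
      δ2 := fun q s msg =>
        (t2.getD ((q.val * 4 + symIdx s) * (m + 2) + msgIdx msg) none).map
          fun e => (toFin n2 e.1, e.2)
      μ1 := fun q s => (u1.getD (q.val * 4 + symIdx s) none).map (toFin m)
      μ2 := fun q s => (u2.getD (q.val * 4 + symIdx s) none).map (toFin m)
      q01 := toFin n1 i1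
      q02 := toFin n2 i2
      F1 := { q | q.val ∈ f1 }
      F2 := { q | q.val ∈ f2 } }

end WK

namespace WKP

/-- greedy ordering with bounded partial sums -/
lemma greedy {X : Type} (f : X → ℤ) (W : ℕ) (s : Multiset X)
    (hW : ∀ x ∈ s, |f x| ≤ W) (h0 : (s.map f).sum = 0) :
    ∀ n ≤ s.card, ∃ l : List X, l.length = n ∧ (l : Multiset X) ≤ s ∧
      ∀ m ≤ n, |((l.take m).map f).sum| ≤ W := by
  intro n
  induction n with
  | zero => intro _; exact ⟨[], rfl, by simp, by intro m _; simp⟩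
  | succ n ih =>
    intro hn
    obtain ⟨l, hl, hls, hp⟩ := ih (by omega)
    obtain ⟨t, rfl⟩ := Multiset.le_iff_exists_add.1 hls
    have ht : t ≠ 0 := by
      rintro rfl
      simp [hl] at hn
    have hS := hp n le_rfl
    rw [List.take_of_length_le (by omega)] at hS
    have hsum : (l.map f).sum + (t.map f).sum = 0 := by
      simpa using h0
    have key : ∃ x ∈ t, |(l.map f).sum + f x| ≤ W := by
      by_cases hc : 0 < (l.map f).sum
      · have : ∃ x ∈ t, f x < 0 := by
          by_contra hcon
          push Not at hcon
          have := Multiset.sum_nonneg (s := t.map f) (by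
            intro x hx
            obtain ⟨y, hy, rfl⟩ := Multiset.mem_map.1 hx
            exact hcon y hy)
          omega
        obtain ⟨x, hx, hx0⟩ := this
        have := hW x (by simp [hx])
        refine ⟨x, hx, ?_⟩
        rw [abs_le] at *
        omega
      · have : ∃ x ∈ t, 0 ≤ f x := by
          by_contra hcon
          push Not at hcon
          obtain ⟨x, hx⟩ := Multiset.exists_mem_of_ne_zero ht
          obtain ⟨t', rfl⟩ := Multiset.exists_cons_of_mem hx
          have h1 := hcon x hx
          have := Multiset.sum_nonneg (s := t'.map (fun x => - f x)) (by
            intro x hx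
            obtain ⟨y, hy, rfl⟩ := Multiset.mem_map.1 hx
            have := hcon y (by simp [hy])
            omega)
          rw [Multiset.sum_map_neg] at this
          simp at hsum
          omega
        obtain ⟨x, hx, hx0⟩ := this
        have := hW x (by simp [hx])
        refine ⟨x, hx, ?_⟩
        rw [abs_le] at *
        omega
    obtain ⟨x, hx, hxW⟩ := key
    refine ⟨l ++ [x], by simp [hl], ?_, ?_⟩
    · rw [← Multiset.coe_add]
      have : (([x] : List X) : Multiset X) ≤ t := by simpa using hx
      gcongr
    · intro m hm
      rcases Nat.lt_or_ge n m with h | h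
      · rw [List.take_of_length_le (by simp; omega)]
        simpa using hxW
      · rw [List.take_append_of_le_length (by omega)]
        exact hp m h

/-- a nonempty small zero-sum sub-multiset -/
lemma small_zero {X : Type} (f : X → ℤ) (W : ℕ) (s : Multiset X)
    (hW : ∀ x ∈ s, |f x| ≤ W) (h0 : (s.map f).sum = 0) (hs : s ≠ 0) :
    ∃ t ≤ s, t ≠ 0 ∧ t.card ≤ 2 * W + 1 ∧ (t.map f).sum = 0 := by
  by_cases hc : s.card ≤ 2 * W + 1
  · exact ⟨s, le_rfl, hs, hc, h0⟩
  obtain ⟨l, hl, hls, hp⟩ := greedy f W s hW h0 (2 * W + 1) (by omega)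
  have hmaps : ∀ m ∈ Finset.range (2 * W + 2),
      ((l.take m).map f).sum ∈ Finset.Icc (-(W : ℤ)) W := by
    intro m hm
    have := hp m (by simp at hm; omega)
    rw [abs_le] at this
    simpa using this
  obtain ⟨a, ha, b, hb, hab, he⟩ := Finset.exists_ne_map_eq_of_card_lt_of_maps_to
    (by simp; omega) hmaps
  wlog hlt : a < b generalizing a b
  · exact this b hb a ha hab.symm he.symm (by omega)
  simp at ha hb
  refine ⟨((l.take b).drop a : List X), ?_, ?_, ?_, ?_⟩
  · refine le_trans ?_ hls
    exact ((List.drop_sublist _ _).trans (List.take_sublist _ _)).subperm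
  · intro h
    have := congrArg Multiset.card h
    simp at this
    omega
  · simp; omega
  · have h1 : l.take b = l.take a ++ (l.take b).drop a := by
      conv_lhs => rw [← List.take_append_drop a (l.take b)]
      rw [List.take_take, min_eq_left hlt.le]
    rw [h1] at he
    simp at he
    simpa using he

lemma partition_one {X : Type} (f : X → ℤ) (W : ℕ) :
    ∀ (n : ℕ) (s : Multiset X), s.card = n → (∀ x ∈ s, |f x| ≤ W) → (s.map f).sum = 0 →
    ∃ P : Multiset (Multiset X), P.sum = s ∧
      ∀ g ∈ P, g.card ≤ 2 * W + 1 ∧ (g.map f).sum = 0 := by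
  intro n
  induction n using Nat.strong_induction_on with
  | _ n ih =>
    intro s hn hW h0
    by_cases hs : s = 0
    · exact ⟨0, by simp [hs], by simp⟩
    obtain ⟨t, hts, ht0, htc, htz⟩ := small_zero f W s hW h0 hs
    obtain ⟨u, rfl⟩ := Multiset.le_iff_exists_add.1 hts
    have h1 : 0 < t.card := Multiset.card_pos.2 ht0
    obtain ⟨P, hP, hg⟩ := ih u.card (by simp at hn; omega) u rfl
      (fun x hx => hW x (by simp [hx])) (by simpa [htz] using h0)
    refine ⟨t ::ₘ P, by simp [hP], ?_⟩
    intro g hg'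
    rcases Multiset.mem_cons.1 hg' with rfl | h
    · exact ⟨htc, htz⟩
    · exact hg g h

/-- bound for sizes of groups -/
def Bd : ℕ → ℕ → ℕ
  | 0, _ => 1
  | D + 1, W => (2 * (W * Bd D W) + 1) * Bd D W

lemma abs_sum_le {X : Type} (f : X → ℤ) (W : ℕ) (s : Multiset X) (hW : ∀ x ∈ s, |f x| ≤ W) :
    |(s.map f).sum| ≤ (W * s.card : ℕ) := by
  induction s using Multiset.induction_on with
  | empty => simp
  | cons a s ih =>
    have h1 := ih (fun x hx => hW x (by simp [hx]))
    have h2 := hW a (by simp)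
    simp only [Multiset.map_cons, Multiset.sum_cons, Multiset.card_cons]
    refine (abs_add_le _ _).trans ?_
    push_cast at *
    linarith

lemma card_sum_le {X : Type} (C : ℕ) (P : Multiset (Multiset X)) (h : ∀ g ∈ P, g.card ≤ C) :
    P.sum.card ≤ P.card * C := by
  induction P using Multiset.induction_on with
  | empty => simp
  | cons a s ih =>
    have h1 := ih (fun x hx => h x (by simp [hx]))
    have h2 := h a (by simp)
    simp only [Multiset.sum_cons, Multiset.card_add, Multiset.card_cons]
    linarith

lemma map_sum_sum {X : Type} (f : X → ℤ) (P : Multiset (Multiset X)) :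
    (P.sum.map f).sum = (P.map (fun g => (g.map f).sum)).sum := by
  induction P using Multiset.induction_on with
  | empty => simp
  | cons a s ih => simp [ih]

lemma partition_all {X : Type} (f : ℕ → X → ℤ) (W : ℕ) (s : Multiset X) :
    ∀ D : ℕ, (∀ x ∈ s, ∀ i < D, |f i x| ≤ W) → (∀ i < D, (s.map (f i)).sum = 0) →
    ∃ P : Multiset (Multiset X), P.sum = s ∧
      ∀ g ∈ P, g.card ≤ Bd D W ∧ ∀ i < D, (g.map (f i)).sum = 0 := by
  intro D
  induction D with
  | zero =>
    intro _ _
    refine ⟨s.map (fun x => {x}), by simp [Multiset.sum_map_singleton], ?_⟩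
    intro g hg
    obtain ⟨x, _, rfl⟩ := Multiset.mem_map.1 hg
    simp [Bd]
  | succ D ih =>
    intro hW h0
    obtain ⟨P, hP, hg⟩ := ih (fun x hx i hi => hW x hx i (by omega)) (fun i hi => h0 i (by omega))
    have hmem : ∀ g ∈ P, ∀ x ∈ g, x ∈ s := by
      intro g hg x hx
      rw [← hP]
      exact Multiset.mem_of_le (Multiset.le_sum_of_mem hg) hx
    obtain ⟨PP, hPP, hgg⟩ := partition_one (fun g : Multiset X => (g.map (f D)).sum)
      (W * Bd D W) P.card P rfl (by
        intro g hg'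
        refine (abs_sum_le (f D) W g (fun x hx => hW x (hmem g hg' x hx) D (by omega))).trans ?_
        have := (hg g hg').1
        exact_mod_cast Nat.mul_le_mul_left W this) (by
        rw [← map_sum_sum, hP]; exact h0 D (by omega))
    refine ⟨PP.map Multiset.sum, ?_, ?_⟩
    · rw [← hP, ← hPP]
      clear hgg hPP
      induction PP using Multiset.induction_on with
      | empty => simp
      | cons a t ih => simp [ih]
    · intro g hg'
      obtain ⟨G, hG, rfl⟩ := Multiset.mem_map.1 hg'
      have hGP : ∀ g ∈ G, g ∈ P := by
        intro g hg
        rw [← hPP]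
        exact Multiset.mem_of_le (Multiset.le_sum_of_mem hG) hg
      refine ⟨?_, ?_⟩
      · refine (card_sum_le (Bd D W) G (fun g hg' => (hg g (hGP g hg')).1)).trans ?_
        exact Nat.mul_le_mul_right _ (hgg G hG).1
      · intro i hi
        rw [map_sum_sum]
        rcases Nat.lt_succ_iff_lt_or_eq.1 hi with h | rfl
        · apply Multiset.sum_eq_zero
          intro x hx
          obtain ⟨g, hg', rfl⟩ := Multiset.mem_map.1 hx
          exact (hg g (hGP g hg')).2 i h
        · exact (hgg G hG).2

end WKP

namespace WKP

section graph
variable {V E : Type} (src dst : E → V)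

def IsPath : V → List E → V → Prop
  | s, [], t => s = t
  | s, e :: l, t => src e = s ∧ IsPath (dst e) l t

lemma IsPath_append {s t u : V} {l l' : List E} (h : IsPath src dst s l t)
    (h' : IsPath src dst t l' u) : IsPath src dst s (l ++ l') u := by
  induction l generalizing s with
  | nil => cases h; exact h'
  | cons e l ih => exact ⟨h.1, ih h.2⟩

lemma IsPath_split {s u : V} {l l' : List E} (h : IsPath src dst s (l ++ l') u) :
    ∃ t, IsPath src dst s l t ∧ IsPath src dst t l' u := by
  induction l generalizing s with
  | nil => exact ⟨s, rfl, h⟩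
  | cons e l ih =>
    obtain ⟨t, h1, h2⟩ := ih h.2
    exact ⟨t, ⟨h.1, h1⟩, h2⟩

/-- visited vertices -/
def Vis (l : List E) (t : V) (v : V) : Prop := v ∈ l.map src ∨ v = t

lemma peel [Fintype V] [DecidableEq V] (t : V) (l : List E) :
    ∀ s, IsPath src dst s l t → ∃ (R Q : List E) (C : Multiset (List E)) (m : V),
      IsPath src dst s R m ∧ IsPath src dst m Q t ∧
      (l : Multiset E) = (R : Multiset E) + (Q : Multiset E) + (C.map (fun c : List E => (c : Multiset E))).sum ∧
      (R.map src).Nodup ∧ (∀ e ∈ R, Vis src Q t (src e)) ∧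
      Q.length ≤ (Fintype.card V + 1) * (Q.map src).toFinset.card ∧
      ∀ c ∈ C, c.length ≤ Fintype.card V + 1 ∧ ∃ v, Vis src Q t v ∧ IsPath src dst v c v := by
  induction l with
  | nil =>
    intro s h
    cases h
    exact ⟨[], [], 0, t, rfl, rfl, by simp, by simp, by simp, by simp, by simp⟩
  | cons e l ih =>
    intro s h
    obtain ⟨rfl, h⟩ := h
    obtain ⟨R, Q, C, m, hR, hQ, hl, hnd, hRv, hlen, hC⟩ := ih _ h
    have hRl : R.length ≤ Fintype.card V := by
      have := hnd.length_le_card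
      simpa using this
    by_cases hv : Vis src Q t (src e)
    · by_cases hr : src e ∈ R.map src
      · obtain ⟨e', he', hee⟩ := List.mem_map.1 hr
        obtain ⟨R1, R2, rfl⟩ := List.append_of_mem he'
        obtain ⟨v, h1, h2⟩ := IsPath_split src dst hR
        have hve : v = src e := by rw [← hee]; exact h2.1.symm
        subst hve
        refine ⟨e' :: R2, Q, (e :: R1) ::ₘ C, m, h2, hQ, ?_, ?_, ?_, hlen, ?_⟩
        · rw [← Multiset.cons_coe, hl]
          rw [Multiset.map_cons, Multiset.sum_cons]
          simp only [← Multiset.coe_add, ← Multiset.cons_coe, ← Multiset.singleton_add]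
          abel
        · rw [List.map_append] at hnd
          exact hnd.of_append_right
        · intro x hx
          exact hRv x (by simp at hx ⊢; tauto)
        · intro c hc
          rcases Multiset.mem_cons.1 hc with rfl | hc
          · refine ⟨by simp at hRl ⊢; omega, src e, hv, rfl, h1⟩
          · exact hC c hc
      · refine ⟨e :: R, Q, C, m, ⟨rfl, hR⟩, hQ, ?_, ?_, ?_, hlen, hC⟩
        · rw [← Multiset.cons_coe, hl]
          simp only [← Multiset.cons_coe, ← Multiset.singleton_add]
          abel
        · simp only [List.map_cons, List.nodup_cons]
          exact ⟨hr, hnd⟩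
        · intro x hx
          rcases List.mem_cons.1 hx with rfl | hx
          · exact hv
          · exact hRv x hx
    · have hmono : ∀ v, Vis src Q t v → Vis src (e :: (R ++ Q)) t v := by
        intro v hv
        rcases hv with h | h
        · left; simp at h ⊢; tauto
        · right; exact h
      refine ⟨[], e :: (R ++ Q), C, src e, rfl, ⟨rfl, IsPath_append src dst hR hQ⟩, ?_, by simp, by simp, ?_, ?_⟩
      · rw [← Multiset.cons_coe, hl]
        simp only [← Multiset.cons_coe, ← Multiset.singleton_add, ← Multiset.coe_add, Multiset.coe_nil]
        abel
      · have hsub : (insert (src e) (Q.map src).toFinset) ⊆ ((e :: (R ++ Q)).map src).toFinset := by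
          intro x hx
          simp at hx ⊢
          tauto
        have hcard := Finset.card_le_card hsub
        rw [Finset.card_insert_of_notMem (by
          intro hx; exact hv (Or.inl (List.mem_toFinset.1 hx)))] at hcard
        calc (e :: (R ++ Q)).length = (R.length + 1) + Q.length := by simp; omega
          _ ≤ (Fintype.card V + 1) + (Fintype.card V + 1) * (Q.map src).toFinset.card := by omega
          _ = (Fintype.card V + 1) * ((Q.map src).toFinset.card + 1) := by ring
          _ ≤ _ := Nat.mul_le_mul_left _ hcard
      · intro c hc
        obtain ⟨h1, v, h2, h3⟩ := hC c hc
        exact ⟨h1, v, hmono v h2, h3⟩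

/-- insert cycles in a path -/
lemma insert_cycles (s t : V) (p : List E) (hp : IsPath src dst s p t) (C : Multiset (List E))
    (hC : ∀ c ∈ C, ∃ v, Vis src p t v ∧ IsPath src dst v c v) :
    ∃ p', IsPath src dst s p' t ∧
      (p' : Multiset E) = (p : Multiset E) + (C.map (fun c : List E => (c : Multiset E))).sum := by
  induction C using Multiset.induction_on with
  | empty => exact ⟨p, hp, by simp⟩
  | cons c C ih =>
    obtain ⟨p', h1, h2⟩ := ih (fun c hc => hC c (by simp [hc]))
    obtain ⟨v, hv, hc⟩ := hC c (by simp)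
    have hv' : Vis src p' t v := by
      rcases hv with h | h
      · left
        obtain ⟨e, he, rfl⟩ := List.mem_map.1 h
        apply List.mem_map_of_mem
        rw [← Multiset.mem_coe, h2]
        simp [he]
      · right; exact h
    have : ∃ a b, p' = a ++ b ∧ IsPath src dst s a v ∧ IsPath src dst v b t := by
      rcases hv' with h | h
      · obtain ⟨e, he, rfl⟩ := List.mem_map.1 h
        obtain ⟨a, b, rfl⟩ := List.append_of_mem he
        obtain ⟨u, hu1, hu2⟩ := IsPath_split src dst h1
        have : u = src e := hu2.1.symm
        subst this
        exact ⟨a, e :: b, rfl, hu1, hu2⟩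
      · subst h
        exact ⟨p', [], by simp, h1, rfl⟩
    obtain ⟨a, b, rfl, ha, hb⟩ := this
    refine ⟨a ++ (c ++ b), IsPath_append src dst ha (IsPath_append src dst hc hb), ?_⟩
    rw [← Multiset.coe_add] at h2
    rw [← Multiset.coe_add, ← Multiset.coe_add, Multiset.map_cons, Multiset.sum_cons,
      ← add_assoc, add_right_comm, h2]
    abel

end graph

/-- Weight of edge lists -/
def GW (N c : ℕ) : ℕ := c * ((N + 2) * (N + 2))
def GB (D N c : ℕ) : ℕ := ((N + 2) * (N + 2)) * (Bd D (GW N c))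

lemma list_abs_sum_le {X : Type} (f : X → ℤ) (W : ℕ) (s : List X) (hW : ∀ x ∈ s, |f x| ≤ W) :
    |(s.map f).sum| ≤ (W * s.length : ℕ) := by
  have := abs_sum_le f W (s : Multiset X) (by simpa using hW)
  simpa using this

lemma map_map_sum {X : Type} (f : X → ℤ) (C : Multiset (List X)) :
    (((C.map (fun c : List X => (c : Multiset X))).sum).map f).sum = (C.map (fun c => (c.map f).sum)).sum := by
  induction C using Multiset.induction_on with
  | empty => simp
  | cons a s ih => simp [ih]

/-- Pumping for zero-weight paths. -/
theorem graph_pump {V E : Type} [Fintype V] (src dst : E → V) (D c : ℕ)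
    (wt : ℕ → E → ℤ) (hwt : ∀ i e, |wt i e| ≤ c) (len : E → ℕ) (hlen : ∀ e, len e ≤ 1)
    (N : ℕ) (hN : Fintype.card V ≤ N) (s t : V) (l : List E) (hl : IsPath src dst s l t)
    (hz : ∀ i < D, (l.map (wt i)).sum = 0) :
    ∃ L0 ≤ GB D N c, ∃ C ≤ GB D N c, (GB D N c < (l.map len).sum → 0 < C) ∧
      ∀ n : ℕ, ∃ l', IsPath src dst s l' t ∧ (∀ i < D, (l'.map (wt i)).sum = 0) ∧
        (l'.map len).sum = L0 + n * C := by
  classical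
  obtain ⟨R, Q, C, m, hR, hQ, hsum, hnd, hRv, hQl, hC⟩ := peel src dst t l s hl
  set p := R ++ Q with hp
  have hpath : IsPath src dst s p t := IsPath_append src dst hR hQ
  have hRl : R.length ≤ Fintype.card V := by
    have := hnd.length_le_card
    simpa using this
  have hpl : p.length ≤ (N + 2) * (N + 2) := by
    have h1 : (Q.map src).toFinset.card ≤ Fintype.card V := Finset.card_le_univ _
    have h2 : (Fintype.card V + 1) * (Q.map src).toFinset.card ≤ (N + 1) * N :=
      Nat.mul_le_mul (by omega) (by omega)
    simp only [hp, List.length_append]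
    nlinarith
  have hCl : ∀ c ∈ C, c.length ≤ (N + 2) * (N + 2) := by
    intro c hc
    have := (hC c hc).1
    nlinarith
  have hCv : ∀ c ∈ C, ∃ v, Vis src p t v ∧ IsPath src dst v c v := by
    intro c hc
    obtain ⟨_, v, h1, h2⟩ := hC c hc
    refine ⟨v, ?_, h2⟩
    rcases h1 with h | h
    · left; simp [hp] at h ⊢; tauto
    · right; exact h
  have hsum' : (l : Multiset E) = (p : Multiset E) + (C.map (fun c : List E => (c : Multiset E))).sum := by
    rw [hsum, hp, ← Multiset.coe_add]
  have hmapsum : ∀ f : E → ℤ, (l.map f).sum = (p.map f).sum + (C.map (fun c => (c.map f).sum)).sum := by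
    intro f
    rw [← map_map_sum]
    have := congrArg (fun M => (Multiset.map f M).sum) hsum'
    simpa using this
  set F : ℕ → List E → ℤ := fun i c => (c.map (wt i)).sum with hF
  obtain ⟨P, hP, hg⟩ := partition_all F (GW N c) (p ::ₘ C) D (by
      intro x hx i _
      have hxl : x.length ≤ (N + 2) * (N + 2) := by
        rcases Multiset.mem_cons.1 hx with rfl | h
        · exact hpl
        · exact hCl x h
      refine (list_abs_sum_le (wt i) c x (fun e _ => hwt i e)).trans ?_
      exact_mod_cast Nat.mul_le_mul_left c hxl) (by
      intro i hi
      rw [Multiset.map_cons, Multiset.sum_cons, ← hz i hi, hmapsum])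
  have hlenlist : ∀ x : List E, (x.map len).sum ≤ x.length := by
    intro x
    have := List.sum_le_card_nsmul (x.map len) 1 (by
      intro y hy
      obtain ⟨e, _, rfl⟩ := List.mem_map.1 hy
      exact hlen e)
    simpa using this
  -- total length of a group
  set G : Multiset (List E) → ℕ := fun g => (g.map (fun x => (x.map len).sum)).sum with hG
  have hGB : ∀ g ∈ P, G g ≤ GB D N c := by
    intro g hgP
    have h1 : ∀ x ∈ g, (x.map len).sum ≤ (N + 2) * (N + 2) := by
      intro x hx
      have hx' : x ∈ p ::ₘ C := by
        rw [← hP]; exact Multiset.mem_of_le (Multiset.le_sum_of_mem hgP) hx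
      refine (hlenlist x).trans ?_
      rcases Multiset.mem_cons.1 hx' with rfl | h
      · exact hpl
      · exact hCl x h
    have h2 := Multiset.sum_le_card_nsmul (g.map (fun x => (x.map len).sum)) ((N + 2) * (N + 2)) (by
      intro y hy
      obtain ⟨x, hx, rfl⟩ := Multiset.mem_map.1 hy
      exact h1 x hx)
    refine h2.trans ?_
    simp only [Multiset.card_map, smul_eq_mul, GB]
    rw [Nat.mul_comm]
    exact Nat.mul_le_mul_left _ (hg g hgP).1
  have hpin : p ∈ P.sum := by rw [hP]; simp
  obtain ⟨g0, hg0P, hpg0⟩ := Multiset.mem_join.1 hpin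
  obtain ⟨rest, rfl⟩ := Multiset.exists_cons_of_mem hpg0
  obtain ⟨P', rfl⟩ := Multiset.exists_cons_of_mem hg0P
  have hCeq : C = rest + P'.sum := by
    rw [Multiset.sum_cons, Multiset.cons_add] at hP
    exact ((Multiset.cons_inj_right p).1 hP).symm
  have hrestC : ∀ x ∈ rest, x ∈ C := by intro x hx; rw [hCeq]; simp [hx]
  have hmain : ∀ g1 : Multiset (List E), (∀ x ∈ g1, x ∈ C) → (∀ i < D, (g1.map (F i)).sum = 0) →
      ∀ n : ℕ, ∃ l', IsPath src dst s l' t ∧ (∀ i < D, (l'.map (wt i)).sum = 0) ∧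
        (l'.map len).sum = G (p ::ₘ rest) + n * G g1 := by
    intro g1 hg1 hz1 n
    obtain ⟨l', h1, h2⟩ := insert_cycles src dst s t p hpath (rest + n • g1) (by
      intro x hx
      rcases Multiset.mem_add.1 hx with h | h
      · exact hCv x (hrestC x h)
      · exact hCv x (hg1 x (Multiset.mem_of_mem_nsmul h)))
    refine ⟨l', h1, ?_, ?_⟩
    · intro i hi
      have e1 := congrArg (fun M => (Multiset.map (wt i) M).sum) h2
      simp only [Multiset.map_coe, Multiset.sum_coe, Multiset.map_add, Multiset.sum_add,
        Multiset.map_nsmul, Multiset.sum_nsmul] at e1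
      have e2 := (hg _ hg0P).2 i hi
      have e3 := hz1 i hi
      have e4 := map_map_sum (wt i) rest
      have e5 := map_map_sum (wt i) g1
      simp only [hF, Multiset.map_cons, Multiset.sum_cons] at e2 e3
      rw [e1, e4, e5, e3, smul_zero, add_zero]
      exact e2
    · have e1 := congrArg (fun M => (Multiset.map len M).sum) h2
      have aux : ∀ C : Multiset (List E),
        (((C.map (fun c : List E => (c : Multiset E))).sum).map len).sum = (C.map (fun c => (c.map len).sum)).sum := by
        intro C
        induction C using Multiset.induction_on with
        | empty => simp
        | cons a s ih => simp [ih]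
      simp only [Multiset.map_coe, Multiset.sum_coe, Multiset.map_add, Multiset.sum_add,
        Multiset.map_nsmul, Multiset.sum_nsmul] at e1
      rw [e1, aux, aux]
      simp [hG, add_assoc]
  refine ⟨G (p ::ₘ rest), hGB _ hg0P, ?_⟩
  by_cases hbig : ∃ g1 ∈ P', 0 < G g1
  · obtain ⟨g1, hg1, hpos⟩ := hbig
    refine ⟨G g1, hGB g1 (by simp [hg1]), fun _ => hpos, hmain g1 ?_ (hg g1 (by simp [hg1])).2⟩
    intro x hx
    rw [hCeq]
    exact Multiset.mem_add.2 (Or.inr (Multiset.mem_of_le (Multiset.le_sum_of_mem hg1) hx))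
  · refine ⟨0, Nat.zero_le _, ?_, ?_⟩
    · intro hlt
      exfalso
      push Not at hbig
      have h1 : (l.map len).sum = G (p ::ₘ C) := by
        have e1 := congrArg (fun M => (Multiset.map len M).sum) hsum'
        have aux : ∀ C : Multiset (List E),
          (((C.map (fun c : List E => (c : Multiset E))).sum).map len).sum = (C.map (fun c => (c.map len).sum)).sum := by
          intro C
          induction C using Multiset.induction_on with
          | empty => simp
          | cons a s ih => simp [ih]
        simp only [Multiset.map_coe, Multiset.sum_coe, Multiset.map_add, Multiset.sum_add] at e1
        rw [e1, aux]
        simp [hG]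
      have h2 : G P'.sum = 0 := by
        clear hP hg hGB hpin hg0P hCeq
        induction P' using Multiset.induction_on with
        | empty => simp [hG]
        | cons a q ih =>
          have h3 := hbig a (by simp)
          have h4 := ih (fun g hg => hbig g (by simp [hg]))
          simp only [hG, Multiset.sum_cons, Multiset.map_add, Multiset.sum_add] at h3 h4 ⊢
          omega
      have h3 : G (p ::ₘ C) = G (p ::ₘ rest) + G P'.sum := by
        rw [hCeq]; simp [hG, add_assoc]
      have := hGB _ hg0P
      omega
    · intro n
      obtain ⟨l', h1, h2, h3⟩ := hmain 0 (by simp) (by simp) n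
      exact ⟨l', h1, h2, by simpa [hG] using h3⟩

end WKP

namespace WKP

structure Track (S Q : Type) where
  eps : S → Q → Q → (ℕ → ℤ) → Prop
  adv : S → S → Q → Q → (ℕ → ℤ) → Prop

section
variable {S Q Q' : Type}

inductive Run (T : Track S Q) : S → Q → List S → S → Q → (ℕ → ℤ) → Prop
  | nil (a q) : Run T a q [] a q 0
  | eps {a q q' l b q'' w v} : T.eps a q q' w → Run T a q' l b q'' v → Run T a q l b q'' (w + v)
  | adv {a a' q q' l b q'' w v} : T.adv a a' q q' w → Run T a' q' l b q'' v →
      Run T a q (a' :: l) b q'' (w + v)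

lemma Run.append {T : Track S Q} {a q l b q' v c q'' l' v'} (h : Run T a q l b q' v)
    (h' : Run T b q' l' c q'' v') : Run T a q (l ++ l') c q'' (v + v') := by
  induction h with
  | nil => simpa using h'
  | eps h1 _ ih => rw [add_assoc]; exact Run.eps h1 (ih h')
  | adv h1 _ ih => rw [add_assoc]; exact Run.adv h1 (ih h')

def Track.prod (T : Track S Q) (T' : Track S Q') : Track S (Q × Q') where
  eps a x y w := (T.eps a x.1 y.1 w ∧ x.2 = y.2) ∨ (x.1 = y.1 ∧ T'.eps a x.2 y.2 w)
  adv a a' x y w := ∃ w1 w2, T.adv a a' x.1 y.1 w1 ∧ T'.adv a a' x.2 y.2 w2 ∧ w = w1 + w2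

lemma Run.prod_fst {T : Track S Q} {T' : Track S Q'} {a x l b y v}
    (h : Run (T.prod T') a x l b y v) :
    ∃ v1 v2, v = v1 + v2 ∧ Run T a x.1 l b y.1 v1 ∧ Run T' a x.2 l b y.2 v2 := by
  induction h with
  | nil a q => exact ⟨0, 0, by simp, Run.nil _ _, Run.nil _ _⟩
  | eps h1 _ ih =>
    obtain ⟨v1, v2, rfl, h2, h3⟩ := ih
    rcases h1 with ⟨h, e⟩ | ⟨e, h⟩
    · exact ⟨_, v2, (add_assoc _ _ _).symm, Run.eps h h2, e ▸ h3⟩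
    · exact ⟨v1, _, add_left_comm _ _ _, e ▸ h2, Run.eps h h3⟩
  | adv h1 _ ih =>
    obtain ⟨v1, v2, rfl, h2, h3⟩ := ih
    obtain ⟨w1, w2, h4, h5, rfl⟩ := h1
    exact ⟨_, _, add_add_add_comm _ _ _ _, Run.adv h4 h2, Run.adv h5 h3⟩

lemma Run.prod_nil {T : Track S Q} {T' : Track S Q'} {a q l b q' v} (p : Q) (hl : l = [])
    (h : Run T' a q l b q' v) : Run (T.prod T') a (p, q) l b (p, q') v := by
  induction h with
  | nil a q => exact Run.nil _ _
  | eps h1 _ ih => refine Run.eps ?_ (ih hl); exact Or.inr ⟨rfl, h1⟩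
  | adv => cases hl

lemma Run.prod_mk {T : Track S Q} {T' : Track S Q'} {a p l b p' v1}
    (h : Run T a p l b p' v1) : ∀ {q q' v2}, Run T' a q l b q' v2 →
    Run (T.prod T') a (p, q) l b (p', q') (v1 + v2) := by
  induction h with
  | nil a q => intro q q' v2 h; simpa using Run.prod_nil _ rfl h
  | eps h1 _ ih =>
    intro q q' v2 h
    rw [add_assoc]
    refine Run.eps ?_ (ih h)
    exact Or.inl ⟨h1, rfl⟩
  | @adv a a' p p1 l b p2 w v h1 h2 ih =>
    intro q q' v2 h
    generalize hL : a' :: l = L at h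
    induction h with
    | nil => cases hL
    | eps h3 _ ih' =>
      rw [add_left_comm]
      refine Run.eps ?_ (ih' h1 h2 ih hL)
      exact Or.inr ⟨rfl, h3⟩
    | adv h3 h4 _ =>
      cases hL
      rw [add_add_add_comm]
      refine Run.adv ?_ (ih h4)
      exact ⟨_, _, h1, h3, rfl⟩

structure TE (T : Track S Q) where
  src : S × Q
  dst : S × Q
  ad : Bool
  w : ℕ → ℤ
  ok : (ad = true ∧ T.adv src.1 dst.1 src.2 dst.2 w) ∨
    (ad = false ∧ src.1 = dst.1 ∧ T.eps src.1 src.2 dst.2 w)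

lemma Run.toPath {T : Track S Q} {a q l b q' v} (h : Run T a q l b q' v) :
    ∃ p : List (TE T), IsPath TE.src TE.dst (a, q) p (b, q') ∧
      (∀ i, (p.map (fun e => e.w i)).sum = v i) ∧
      (p.map (fun e => cond e.ad 1 0)).sum = l.length := by
  induction h with
  | nil a q => exact ⟨[], rfl, by simp, by simp⟩
  | @eps a q q' l b q'' w v h1 _ ih =>
    obtain ⟨p, hp, hw, hl⟩ := ih
    refine ⟨⟨(a, q), (a, q'), false, w, Or.inr ⟨rfl, rfl, h1⟩⟩ :: p, ⟨rfl, hp⟩, ?_, ?_⟩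
    · intro i; simp [hw]
    · simp [hl]
  | @adv a a' q q' l b q'' w v h1 _ ih =>
    obtain ⟨p, hp, hw, hl⟩ := ih
    refine ⟨⟨(a, q), (a', q'), true, w, Or.inl ⟨rfl, h1⟩⟩ :: p, ⟨rfl, hp⟩, ?_, ?_⟩
    · intro i; simp [hw]
    · simp [hl]; omega

lemma Run.ofPath {T : Track S Q} (p : List (TE T)) : ∀ {x y},
    IsPath TE.src TE.dst x p y → ∃ l v, Run T x.1 x.2 l y.1 y.2 v ∧
      (∀ i, (p.map (fun e => e.w i)).sum = v i) ∧
      (p.map (fun e => cond e.ad 1 0)).sum = l.length := by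
  induction p with
  | nil =>
    intro x y h
    cases h
    exact ⟨[], 0, Run.nil _ _, by simp, by simp⟩
  | cons e p ih =>
    intro x y h
    obtain ⟨rfl, h⟩ := h
    obtain ⟨l, v, hr, hw, hl⟩ := ih h
    rcases e.ok with ⟨h1, h2⟩ | ⟨h1, h2, h3⟩
    · refine ⟨_, _, Run.adv h2 hr, ?_, ?_⟩
      · intro i; simp [hw]
      · simp [hl, h1]; omega
    · rw [← h2] at hr
      refine ⟨_, _, Run.eps h3 hr, ?_, ?_⟩
      · intro i; simp [hw]
      · simp [hl, h1]

def Track.Bdd (T : Track S Q) (c : ℕ) : Prop :=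
  (∀ a q q' w, T.eps a q q' w → ∀ i, |w i| ≤ c) ∧
  (∀ a a' q q' w, T.adv a a' q q' w → ∀ i, |w i| ≤ c)

lemma Track.Bdd.prod {T : Track S Q} {T' : Track S Q'} {c c' : ℕ} (h : T.Bdd c) (h' : T'.Bdd c') :
    (T.prod T').Bdd (c + c') := by
  constructor
  · rintro a q q' w (⟨h1, _⟩ | ⟨_, h1⟩) i
    · have := h.1 _ _ _ _ h1 i
      push_cast; omega
    · have := h'.1 _ _ _ _ h1 i
      push_cast; omega
  · rintro a a' q q' w ⟨w1, w2, h1, h2, rfl⟩ i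
    have e1 := h.2 _ _ _ _ _ h1 i
    have e2 := h'.2 _ _ _ _ _ h2 i
    refine (abs_add_le _ _).trans ?_
    push_cast; omega

theorem track_pump [Fintype S] [Fintype Q] (T : Track S Q) (D c : ℕ) (hT : T.Bdd c) (N : ℕ)
    (hN : Fintype.card (S × Q) ≤ N) {a q l b q' v} (h : Run T a q l b q' v)
    (hz : ∀ i < D, v i = 0) :
    ∃ L0 ≤ GB D N c, ∃ C ≤ GB D N c, (GB D N c < l.length → 0 < C) ∧
      ∀ n : ℕ, ∃ l' v', Run T a q l' b q' v' ∧ (∀ i < D, v' i = 0) ∧ l'.length = L0 + n * C := by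
  obtain ⟨p, hp, hw, hl⟩ := h.toPath
  obtain ⟨L0, h0, C, hC, hpos, hmain⟩ := graph_pump TE.src TE.dst D c (fun i (e : TE T) => e.w i)
    (by
      intro i e
      rcases e.ok with ⟨_, h2⟩ | ⟨_, _, h3⟩
      · exact hT.2 _ _ _ _ _ h2 i
      · exact hT.1 _ _ _ _ h3 i) (fun e => cond e.ad 1 0) (by intro e; cases e.ad <;> simp) N hN _ _ p hp
    (by intro i hi; rw [hw, hz i hi])
  refine ⟨L0, h0, C, hC, by rwa [hl] at hpos, ?_⟩
  intro n
  obtain ⟨p', hp', hz', hl'⟩ := hmain n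
  obtain ⟨l', v', hr, hw', hll⟩ := Run.ofPath p' hp'
  refine ⟨l', v', hr, ?_, by omega⟩
  intro i hi
  rw [← hw']; exact hz' i hi

end
end WKP

namespace WKP
open WK

abbrev Sy := TSym Bool

def rest (w : List Bool) (i : ℕ) : List Sy := (w.map Sum.inl ++ [Sum.inr true]).drop i

lemma tape_zero (w : List Bool) : tape w 0 = Sum.inr false := by simp [tape]

lemma tape_succ (w : List Bool) (i : ℕ) :
    tape w (i + 1) = (w.map Sum.inl ++ [Sum.inr true]).getD i (Sum.inr true) := by
  simp [tape]

lemma tape_mid (w : List Bool) (i : ℕ) (h : i < w.length) :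
    tape w (i + 1) = Sum.inl w[i] := by
  rw [tape_succ, List.getD_append _ _ _ _ (by simpa using h)]
  simp [h]

lemma tape_end (w : List Bool) (i : ℕ) (h : w.length + 1 ≤ i) : tape w i = Sum.inr true := by
  obtain ⟨i, rfl⟩ : ∃ j, i = j + 1 := ⟨i - 1, by omega⟩
  rw [tape_succ, List.getD_append_right _ _ _ _ (by simp; omega)]
  simp only [List.length_map]
  rcases Nat.eq_zero_or_pos (i - w.length) with h | h
  · simp [h]
  · rw [List.getD_eq_default _ _ (by simp; omega)]

lemma tape_eq_left (w : List Bool) (i : ℕ) : tape w i = Sum.inr false ↔ i = 0 := by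
  constructor
  · intro h
    rcases i with _ | i
    · rfl
    · rcases Nat.lt_or_ge i w.length with h' | h'
      · rw [tape_mid w i h'] at h; cases h
      · rw [tape_end w _ (by omega)] at h; cases h
  · rintro rfl; exact tape_zero w

lemma tape_eq_right (w : List Bool) (i : ℕ) : tape w i = Sum.inr true ↔ w.length + 1 ≤ i := by
  constructor
  · intro h
    by_contra hc
    rcases i with _ | i
    · rw [tape_zero] at h; cases h
    · rw [tape_mid w i (by omega)] at h; cases h
  · exact tape_end w i

lemma rest_end (w : List Bool) (i : ℕ) (h : w.length + 1 ≤ i) : rest w i = [] := by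
  apply List.drop_eq_nil_of_le
  simpa using h

lemma rest_cons (w : List Bool) (i : ℕ) (h : i < w.length + 1) :
    rest w i = tape w (i + 1) :: rest w (i + 1) := by
  unfold rest
  rw [List.drop_eq_getElem_cons (by simpa using h), tape_succ, List.getD_eq_getElem]

section
variable (A : DPWK Bool)

abbrev Lb := Option A.M × Option A.M

variable {A}

def ev (lb : Lb A) : Bool := lb.1.isSome || lb.2.isSome
def evs (ls : List (Lb A)) : List (Lb A) := ls.filter ev

lemma ev_false {lb : Lb A} (h : ev lb = false) : lb = (none, none) := by
  rcases lb with ⟨_ | a, _ | b⟩ <;> simp [ev] at h ⊢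

def stepU (a : Sy) (p : A.Q1) (lb : Lb A) (p' : A.Q1) (d : Bool) : Prop :=
  A.μ1 p a = lb.1 ∧ A.δ1 p a lb.2 = some (p', d)

def stepL (a : Sy) (q : A.Q2) (lb : Lb A) (q' : A.Q2) (d : Bool) : Prop :=
  A.μ2 q a = lb.2 ∧ A.δ2 q a lb.1 = some (q', d)

inductive URun (w : List Bool) : A.Q1 → ℕ → List (Lb A) → A.Q1 → ℕ → Prop
  | nil (p i) : URun w p i [] p i
  | cons {p i lb p' d ls pf f} : stepU (tape w i) p lb p' d → URun w p' (i + cond d 1 0) ls pf f →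
      URun w p i (lb :: ls) pf f

inductive LRun (w : List Bool) : A.Q2 → ℕ → List (Lb A) → A.Q2 → ℕ → Prop
  | nil (p i) : LRun w p i [] p i
  | cons {p j j' lb p' d ls pf f} : stepL (tape w j) p lb p' d → j = j' + cond d 1 0 →
      LRun w p' j' ls pf f → LRun w p j (lb :: ls) pf f

def ph (E : List (Lb A)) (wt : ℕ → ℕ → ℤ) (r : ℕ) (lb : Lb A) (r' : ℕ) (w : ℕ → ℤ) : Prop :=
  (ev lb = false ∧ r' = r ∧ w = wt r) ∨ (ev lb = true ∧ E[r]? = some lb ∧ r' = r + 1 ∧ w = 0)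

def Wsum (wt : ℕ → ℕ → ℤ) : ℕ → List (Lb A) → ℕ → ℤ
  | _, [] => 0
  | r, lb :: ls => if ev lb then Wsum wt (r + 1) ls else wt r + Wsum wt r ls

variable (A)

def upT (E : List (Lb A)) (K : ℕ) (wt : ℕ → ℕ → ℤ) (pf : A.Q1) (af : Sy) :
    Track Sy (Option (A.Q1 × Fin (K + 1))) where
  eps a s s' w :=
    (∃ p r p' r' lb d, s = some (p, r) ∧ s' = some (p', r') ∧ stepU a p lb p' d ∧
      (d = true → a = Sum.inr true) ∧ ph E wt r.val lb r'.val w) ∨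
    (∃ r, s = some (pf, r) ∧ r.val = E.length ∧ a = af ∧ s' = none ∧ w = 0)
  adv a a' s s' w := a ≠ Sum.inr true ∧ a' ≠ Sum.inr false ∧
    ((s = none ∧ s' = none ∧ w = 0) ∨
    (∃ p r p' r' lb, s = some (p, r) ∧ s' = some (p', r') ∧ stepU a p lb p' true ∧
      ph E wt r.val lb r'.val w))

def loT (E : List (Lb A)) (K : ℕ) (wt : ℕ → ℕ → ℤ) (qf : A.Q2) (bf : Sy) :
    Track Sy (Option (A.Q2 × Fin (K + 1))) where
  eps a s s' w :=
    (∃ q r q' r' lb, s = some (q', r') ∧ s' = some (q, r) ∧ stepL a q lb q' false ∧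
      ph E wt r.val lb r'.val w) ∨
    (∃ r, s' = some (qf, r) ∧ r.val = E.length ∧ a = bf ∧ s = none ∧ w = 0)
  adv _ a' s s' w :=
    ((s = none ∧ s' = none ∧ w = 0) ∨
    (∃ q r q' r' lb, s = some (q', r') ∧ s' = some (q, r) ∧ stepL a' q lb q' true ∧
      ph E wt r.val lb r'.val w))

variable {A}

lemma ph_bdd {E : List (Lb A)} {wt : ℕ → ℕ → ℤ} (hwt : ∀ r i, |wt r i| ≤ 1) {r lb r' w}
    (h : ph E wt r lb r' w) (i : ℕ) : |w i| ≤ (1 : ℕ) := by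
  rcases h with ⟨_, _, rfl⟩ | ⟨_, _, _, rfl⟩
  · exact hwt r i
  · simp

lemma upT_bdd {E : List (Lb A)} {K : ℕ} {wt : ℕ → ℕ → ℤ} (hwt : ∀ r i, |wt r i| ≤ 1) {pf af} :
    (upT A E K wt pf af).Bdd 1 := by
  constructor
  · rintro a q q' w (⟨p, r, p', r', lb, d, _, _, _, _, h⟩ | ⟨r, _, _, _, _, rfl⟩) i
    · exact ph_bdd hwt h i
    · simp
  · rintro a a' q q' w ⟨_, _, ⟨_, _, rfl⟩ | ⟨p, r, p', r', lb, _, _, _, h⟩⟩ i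
    · simp
    · exact ph_bdd hwt h i

lemma loT_bdd {E : List (Lb A)} {K : ℕ} {wt : ℕ → ℕ → ℤ} (hwt : ∀ r i, |wt r i| ≤ 1) {pf af} :
    (loT A E K wt pf af).Bdd 1 := by
  constructor
  · rintro a q q' w (⟨p, r, p', r', lb, _, _, _, h⟩ | ⟨r, _, _, _, _, rfl⟩) i
    · exact ph_bdd hwt h i
    · simp
  · rintro a a' q q' w (⟨_, _, rfl⟩ | ⟨p, r, p', r', lb, _, _, _, h⟩) i
    · simp
    · exact ph_bdd hwt h i

lemma drop_cons {X : Type} {E : List X} {r : ℕ} {x : X} {t : List X} (h : E.drop r = x :: t) :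
    E[r]? = some x ∧ E.drop (r + 1) = t ∧ r < E.length := by
  have hr : r < E.length := by
    by_contra hc
    rw [List.drop_eq_nil_of_le (by omega)] at h
    cases h
  rw [List.drop_eq_getElem_cons hr] at h
  injection h with h1 h2
  exact ⟨by simp [hr, h1], h2, hr⟩

lemma drop_of {X : Type} {E : List X} {r : ℕ} {x : X} (h : E[r]? = some x) :
    E.drop r = x :: E.drop (r + 1) := by
  obtain ⟨hr, rfl⟩ := List.getElem?_eq_some_iff.1 h
  exact List.drop_eq_getElem_cons hr

/-- phase bookkeeping, forward direction -/
lemma ph_fwd {E : List (Lb A)} {K : ℕ} (hE : E.length ≤ K) (wt : ℕ → ℕ → ℤ) {r : Fin (K + 1)}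
    (hr : r.val ≤ E.length) {lb : Lb A} {ls} (h : evs (lb :: ls) = E.drop r) :
    ∃ r' : Fin (K + 1), ∃ w, r'.val ≤ E.length ∧ evs ls = E.drop r' ∧ ph E wt r lb r' w ∧
      Wsum wt r (lb :: ls) = w + Wsum wt r' ls := by
  by_cases he : ev lb = true
  · have h' : E.drop r = lb :: evs ls := by rw [← h]; simp [evs, he]
    obtain ⟨h1, h2, h3⟩ := drop_cons h'
    exact ⟨⟨r + 1, by omega⟩, 0, h3, h2.symm, Or.inr ⟨he, h1, rfl, rfl⟩, by simp [Wsum, he]⟩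
  · have he' : ev lb = false := by simpa using he
    exact ⟨r, wt r, hr, by rw [← h]; simp [evs, he'], Or.inl ⟨he', rfl, rfl⟩, by simp [Wsum, he']⟩

lemma ph_bwd {E : List (Lb A)} {wt : ℕ → ℕ → ℤ} {r r' : ℕ} {lb : Lb A} {w ls}
    (h : ph E wt r lb r' w) (h' : evs ls = E.drop r') :
    evs (lb :: ls) = E.drop r ∧ Wsum wt r (lb :: ls) = w + Wsum wt r' ls := by
  rcases h with ⟨he, rfl, rfl⟩ | ⟨he, h1, rfl, rfl⟩
  · exact ⟨by rw [← h']; simp [evs, he], by simp [Wsum, he]⟩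
  · refine ⟨?_, by simp [Wsum, he]⟩
    rw [drop_of h1, ← h']; simp [evs, he]

lemma up_done {E : List (Lb A)} {K : ℕ} {wt : ℕ → ℕ → ℤ} {pf af} (w : List Bool) :
    ∀ m i, w.length + 1 - i = m →
    Run (upT A E K wt pf af) (tape w i) none (rest w i) (Sum.inr true) none 0 := by
  intro m
  induction m with
  | zero =>
    intro i hi
    rw [rest_end w i (by omega), tape_end w i (by omega)]
    exact Run.nil _ _
  | succ m ih =>
    intro i hi
    rw [rest_cons w i (by omega), ← add_zero (0 : ℕ → ℤ)]
    refine Run.adv ⟨?_, ?_, Or.inl ⟨rfl, rfl, rfl⟩⟩ (ih (i + 1) (by omega))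
    · rw [Ne, tape_eq_right]; omega
    · rw [Ne, tape_eq_left]; omega

lemma up_fwd {E : List (Lb A)} {K : ℕ} (hE : E.length ≤ K) (wt : ℕ → ℕ → ℤ) {w : List Bool}
    {p i ls pf f} (h : URun (A := A) w p i ls pf f) : ∀ r : Fin (K + 1), r.val ≤ E.length →
    evs ls = E.drop r →
    Run (upT A E K wt pf (tape w f)) (tape w i) (some (p, r)) (rest w i) (Sum.inr true) none
      (Wsum wt r ls) := by
  induction h with
  | nil p i =>
    intro r hr he
    have hrE : r.val = E.length := by
      have : E.drop r = [] := by rw [← he]; rfl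
      rw [List.drop_eq_nil_iff] at this
      omega
    have := up_done (E := E) (K := K) (wt := wt) (pf := p) (af := tape w i) w _ i rfl
    rw [show Wsum wt r ([] : List (Lb A)) = 0 + 0 by simp [Wsum]]
    exact Run.eps (Or.inr ⟨r, rfl, hrE, rfl, rfl, rfl⟩) this
  | @cons p i lb p' d ls pf f hs _ ih =>
    intro r hr he
    obtain ⟨r', v, hr', he', hph, hW⟩ := ph_fwd hE wt hr he
    have := ih r' hr' he'
    rw [hW]
    cases d with
    | false =>
      exact Run.eps (Or.inl ⟨p, r, p', r', lb, false, rfl, rfl, hs, by simp, hph⟩) this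
    | true =>
      simp only [cond_true] at this
      rcases Nat.lt_or_ge i (w.length + 1) with hi | hi
      · rw [rest_cons w i hi]
        refine Run.adv ⟨?_, ?_, Or.inr ⟨p, r, p', r', lb, rfl, rfl, hs, hph⟩⟩ this
        · rw [Ne, tape_eq_right]; omega
        · rw [Ne, tape_eq_left]; omega
      · rw [rest_end w _ (by omega), tape_end w (i + 1) (by omega)] at this
        rw [rest_end w _ hi]
        rw [tape_end w i hi] at hs ⊢
        exact Run.eps (Or.inl ⟨p, r, p', r', lb, true, rfl, rfl, hs, by simp, hph⟩) this

lemma up_bwd {E : List (Lb A)} {K : ℕ} {wt : ℕ → ℕ → ℤ} {w : List Bool}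
    {pf af a s l b s' v} (h : Run (upT A E K wt pf af) a s l b s' v) : 
    ∀ p r i, s = some (p, r) → s' = none → a = tape w i → l = rest w i → 
    ∃ ls f, URun (A := A) w p i ls pf f ∧ tape w f = af ∧ evs ls = E.drop r ∧ v = Wsum wt r ls := by
  induction h with
  | nil a q =>
    intro p r i h1 h2
    rw [h1] at h2; cases h2
  | @eps a q q' l b q'' x v h1 h2 ih =>
    rintro p r i rfl rfl rfl rfl
    rcases h1 with ⟨p0, r0, p', r', lb, d, e1, rfl, hs, hd, hph⟩ | ⟨r0, e1, hr, e2, rfl, rfl⟩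
    · cases e1
      obtain ⟨e3, e4⟩ : tape w i = tape w (i + cond d 1 0) ∧ rest w i = rest w (i + cond d 1 0) := by
        cases d with
        | false => simp
        | true =>
          have := (tape_eq_right w i).1 (hd rfl)
          simp only [cond_true]
          rw [tape_end w i this, tape_end w _ (by omega), rest_end w i this, rest_end w _ (by omega)]
          simp
      obtain ⟨ls, f, k1, k2, k3, k4⟩ := ih p' r' (i + cond d 1 0) rfl rfl e3 e4
      obtain ⟨k5, k6⟩ := ph_bwd hph k3
      exact ⟨lb :: ls, f, URun.cons hs k1, k2, k5, by rw [k6, k4]⟩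
    · cases e1
      refine ⟨[], i, URun.nil _ _, e2, ?_, ?_⟩
      · rw [hr]; simp [evs]
      · have : ∀ {a s l b s' v}, Run (upT A E K wt pf af) a s l b s' v → s = none → v = 0 := by
          intro a s l b s' v h
          induction h with
          | nil => intro _; rfl
          | eps h1 _ _ =>
            rintro rfl
            rcases h1 with ⟨p0, r0, p', r', lb, d, e1, _⟩ | ⟨r0, e1, _⟩ <;> cases e1
          | adv h1 _ ih =>
            rintro rfl
            rcases h1 with ⟨_, _, ⟨_, h2, rfl⟩ | ⟨p0, r0, p', r', lb, e1, _⟩⟩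
            · rw [ih h2]; simp
            · cases e1
        rw [this h2 rfl]; simp [Wsum]
  | @adv a a' q q' l b q'' x v h1 h2 ih =>
    rintro p r i rfl rfl rfl hl
    obtain ⟨ha, _, ⟨e1, _⟩ | ⟨p0, r0, p', r', lb, e1, rfl, hs, hph⟩⟩ := h1
    · cases e1
    · cases e1
      rw [Ne, tape_eq_right] at ha
      rw [rest_cons w i (by omega)] at hl
      cases hl
      obtain ⟨ls, f, k1, k2, k3, k4⟩ := ih p' r' (i + 1) rfl rfl rfl rfl
      obtain ⟨k5, k6⟩ := ph_bwd hph k3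
      exact ⟨lb :: ls, f, URun.cons (d := true) hs k1, k2, k5, by rw [k6, k4]⟩

lemma up_word {E : List (Lb A)} {K : ℕ} {wt : ℕ → ℕ → ℤ} 
    {pf af a s l b s' v} (h : Run (upT A E K wt pf af) a s l b s' v) : b = Sum.inr true →
    (a = Sum.inr true ∧ l = []) ∨ (a ≠ Sum.inr true ∧ ∃ w : List Bool, l = w.map Sum.inl ++ [Sum.inr true]) := by
  induction h with
  | nil => intro h; exact Or.inl ⟨h, rfl⟩
  | eps _ _ ih => exact ih
  | @adv a a' q q' l b q'' x v h1 _ ih =>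
    intro h
    right
    refine ⟨h1.1, ?_⟩
    rcases ih h with ⟨rfl, rfl⟩ | ⟨h2, w, rfl⟩
    · exact ⟨[], rfl⟩
    · have h3 := h1.2.1
      rcases a' with x | _ | _
      · exact ⟨x :: w, by simp⟩
      · exact absurd rfl h3
      · exact absurd rfl h2

lemma take_succ_rest (w : List Bool) (j : ℕ) (h : j < w.length + 1) :
    (rest w 0).take (j + 1) = (rest w 0).take j ++ [tape w (j + 1)] := by
  have : j < (w.map Sum.inl ++ [(Sum.inr true : Sy)]).length := by simpa using h
  unfold rest
  rw [List.drop_zero, List.take_add_one, tape_succ, List.getD_eq_getElem _ _ this]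
  simp [List.getElem?_eq_getElem this]

lemma lo_pre {E : List (Lb A)} {K : ℕ} {wt : ℕ → ℕ → ℤ} {qf bf} (w : List Bool) (j : ℕ)
    (hj : j ≤ w.length + 1) :
    Run (loT A E K wt qf bf) (Sum.inr false) none ((rest w 0).take j) (tape w j) none 0 := by
  induction j with
  | zero => rw [tape_zero]; exact Run.nil _ _
  | succ j ih =>
    rw [take_succ_rest w j (by omega)]
    have := (ih (by omega)).append (Run.adv (T := loT A E K wt qf bf) (a' := tape w (j + 1))
      (Or.inl ⟨rfl, rfl, rfl⟩) (Run.nil _ _))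
    simpa using this

lemma LRun_le {w : List Bool} {q j ls qf f} (h : LRun (A := A) w q j ls qf f) : f ≤ j := by
  induction h with
  | nil => exact le_rfl
  | cons _ _ _ ih => omega

lemma lo_fwd {E : List (Lb A)} {K : ℕ} (hE : E.length ≤ K) (wt : ℕ → ℕ → ℤ) {w : List Bool}
    {q j ls qf f} (h : LRun (A := A) w q j ls qf f) : j ≤ w.length + 1 →
    ∀ r : Fin (K + 1), r.val ≤ E.length → evs ls = E.drop r →
    Run (loT A E K wt qf (tape w f)) (Sum.inr false) none ((rest w 0).take j) (tape w j) (some (q, r))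
      (Wsum wt r ls) := by
  induction h with
  | nil q j =>
    intro hj r hr he
    have hrE : r.val = E.length := by
      have : E.drop r = [] := by rw [← he]; rfl
      rw [List.drop_eq_nil_iff] at this
      omega
    have := (lo_pre (E := E) (K := K) (wt := wt) (qf := q) (bf := tape w j) w j hj).append
      (Run.eps (Or.inr ⟨r, rfl, hrE, rfl, rfl, rfl⟩) (Run.nil _ _))
    simpa [Wsum] using this
  | @cons q j j' lb q' d ls qf f hs hj' _ ih =>
    intro hj r hr he
    obtain ⟨r', v, hr', he', hph, hW⟩ := ph_fwd hE wt hr he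
    have := ih (by omega) r' hr' he'
    rw [hW]
    cases d with
    | false =>
      simp only [cond_false, add_zero] at hj'
      subst hj'
      have := this.append (Run.eps (Or.inl ⟨q, r, q', r', lb, rfl, rfl, hs, hph⟩) (Run.nil _ _))
      simpa [add_comm] using this
    | true =>
      simp only [cond_true] at hj'
      subst hj'
      rw [take_succ_rest w j' (by omega)]
      have := this.append (Run.adv (Or.inr ⟨q, r, q', r', lb, rfl, rfl, hs, hph⟩) (Run.nil _ _))
      simpa [add_comm] using this

def LAcc (w : List Bool) (E : List (Lb A)) {K : ℕ} (wt : ℕ → ℕ → ℤ) (qf : A.Q2) (bf : Sy) :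
    Option (A.Q2 × Fin (K + 1)) → ℕ → (ℕ → ℤ) → Prop
  | none, _, u => u = 0
  | some (q, r), j, u => ∃ ls f, LRun (A := A) w q j ls qf f ∧ tape w f = bf ∧
      evs ls = E.drop r ∧ u = Wsum wt r ls

lemma lo_bwd {E : List (Lb A)} {K : ℕ} {wt : ℕ → ℕ → ℤ} {w : List Bool}
    {qf bf a s l b s' v} (h : Run (loT A E K wt qf bf) a s l b s' v) :
    ∀ j u, j ≤ w.length + 1 → a = tape w j → l = rest w j → LAcc w E wt qf bf s j u →
      LAcc w E wt qf bf s' (w.length + 1) (u + v) := by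
  induction h with
  | nil a q =>
    intro j u hj _ hl hacc
    have : j = w.length + 1 := by
      by_contra hc
      rw [rest_cons w j (by omega)] at hl
      cases hl
    subst this
    simpa using hacc
  | @eps a q q' l b q'' x v h1 h2 ih =>
    rintro j u hj rfl hl hacc
    rw [← add_assoc]
    apply ih j _ hj rfl hl
    rcases h1 with ⟨q0, r, q1, r', lb, rfl, rfl, hs, hph⟩ | ⟨r, rfl, hr, e1, rfl, rfl⟩
    · obtain ⟨ls, f, k1, k2, k3, rfl⟩ := hacc
      obtain ⟨k5, k6⟩ := ph_bwd hph k3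
      exact ⟨lb :: ls, f, LRun.cons hs (by simp) k1, k2, k5, by rw [k6, add_comm]⟩
    · have : u = 0 := hacc
      subst this
      exact ⟨[], j, LRun.nil _ _, e1, by rw [hr]; simp [evs], by simp [Wsum]⟩
  | @adv a a' q q' l b q'' x v h1 h2 ih =>
    rintro j u hj rfl hl hacc
    have hj' : j < w.length + 1 := by
      by_contra hc
      rw [rest_end w j (by omega)] at hl
      cases hl
    rw [rest_cons w j hj'] at hl
    cases hl
    rw [← add_assoc]
    apply ih (j + 1) _ hj' rfl rfl
    rcases h1 with ⟨rfl, rfl, rfl⟩ | ⟨q0, r, q1, r', lb, rfl, rfl, hs, hph⟩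
    · have : u = 0 := hacc
      subst this
      simp [LAcc]
    · obtain ⟨ls, f, k1, k2, k3, rfl⟩ := hacc
      obtain ⟨k5, k6⟩ := ph_bwd hph k3
      exact ⟨lb :: ls, f, LRun.cons hs (by simp) k1, k2, k5, by rw [k6, add_comm]⟩

end
end WKP

namespace WKP
open WK

section
variable {A : DPWK Bool}

def wtp (x : ℕ) (s : ℤ) (r i : ℕ) : ℤ := if i = 2 * r + x then s else 0

lemma wtp_bdd (x : ℕ) (s : ℤ) (hs : |s| ≤ 1) (r i : ℕ) : |wtp x s r i| ≤ 1 := by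
  unfold wtp; split_ifs <;> simp [hs]

def cnt : ℕ → List (Lb A) → ℕ → ℕ
  | _, [], _ => 0
  | r, lb :: ls, i => if ev lb then cnt (r + 1) ls i else (if i = r then 1 else 0) + cnt r ls i

lemma Wsum_cons_not (wt : ℕ → ℕ → ℤ) (lb : Lb A) (ls : List (Lb A)) (r i : ℕ)
    (h : ¬ ev lb = true) : Wsum wt r (lb :: ls) i = wt r i + Wsum wt r ls i := by
  simp [Wsum, h]

lemma Wsum_cnt (x : ℕ) (s : ℤ) (ls : List (Lb A)) (r i : ℕ) :
    Wsum (wtp x s) r ls (2 * i + x) = s * cnt r ls i := by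
  induction ls generalizing r with
  | nil => simp [Wsum, cnt]
  | cons lb ls ih =>
    by_cases h : ev lb = true
    · simp [Wsum, cnt, h, ih]
    · rw [Wsum_cons_not _ _ _ _ _ h, ih]
      by_cases hi : i = r
      · subst hi; simp [wtp, cnt, h]; ring
      · simp [hi, wtp, cnt, h]

lemma Wsum_other (x y : ℕ) (s : ℤ) (ls : List (Lb A)) (r i : ℕ) (h : x % 2 ≠ y % 2) :
    Wsum (wtp x s) r ls (2 * i + y) = 0 := by
  induction ls generalizing r with
  | nil => simp [Wsum]
  | cons lb ls ih =>
    by_cases h' : ev lb = true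
    · simp [Wsum, h', ih]
    · have : ¬ (2 * i + y = 2 * r + x) := by omega
      rw [Wsum_cons_not _ _ _ _ _ h', ih]
      simp [wtp, this]

lemma Wsum_neg (x : ℕ) (ls : List (Lb A)) (r i : ℕ) :
    Wsum (wtp x 1) r ls i + Wsum (wtp x (-1)) r ls i = 0 := by
  induction ls generalizing r with
  | nil => simp [Wsum]
  | cons lb ls ih =>
    by_cases h' : ev lb = true
    · simp [Wsum, h', ih]
    · rw [Wsum_cons_not _ _ _ _ _ h', Wsum_cons_not _ _ _ _ _ h']
      have := ih r
      have e : wtp x 1 r i + wtp x (-1) r i = 0 := by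
        simp only [wtp]; split_ifs <;> simp
      linarith

lemma cnt_lt (ls : List (Lb A)) (r i : ℕ) (h : i < r) : cnt r ls i = 0 := by
  induction ls generalizing r with
  | nil => rfl
  | cons lb ls ih =>
    have : i ≠ r := by omega
    simp [cnt, ih r h, ih (r + 1) (by omega), this]

lemma labels_eq (ls ls' : List (Lb A)) (r : ℕ) (he : evs ls = evs ls')
    (hc : ∀ i ≤ r + (evs ls).length, cnt r ls i = cnt r ls' i) : ls = ls' := by
  induction ls generalizing r ls' with
  | nil =>
    cases ls' with
    | nil => rfl
    | cons lb' ls' =>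
      by_cases h' : ev lb' = true
      · simp [evs, h'] at he
      · have := hc r (by omega)
        simp [cnt, h'] at this
        omega
  | cons lb ls ih =>
    cases ls' with
    | nil =>
      by_cases h : ev lb = true
      · simp [evs, h] at he
      · have := hc r (by omega)
        simp [cnt, h] at this
    | cons lb' ls' =>
      by_cases h : ev lb = true <;> by_cases h' : ev lb' = true
      · simp only [evs, List.filter_cons, h, h', if_true, List.cons.injEq] at he
        obtain ⟨rfl, he⟩ := he
        rw [ih ls' (r + 1) he]
        intro i hi
        have := hc i (by simp only [evs, List.filter_cons, h, if_true, List.length_cons] at hi ⊢; omega)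
        simpa [cnt, h] using this
      · have := hc r (by omega)
        simp [cnt, h, h', cnt_lt] at this
        omega
      · have := hc r (by omega)
        simp [cnt, h, h', cnt_lt] at this
      · have e1 := ev_false (by simpa using h : ev lb = false)
        have e2 := ev_false (by simpa using h' : ev lb' = false)
        rw [e1, e2]
        rw [ih ls' r (by simpa [evs, h, h'] using he)]
        intro i hi
        have := hc i (by simpa [evs, h] using hi)
        simpa [cnt, h, h'] using this

def Cert (A : DPWK Bool) (K : ℕ) (G : ℕ → A.Q1 → Sy → A.Q2 → Sy → Prop) (w : List Bool) : Prop :=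
  ∃ ls pf f qf g, URun (A := A) w A.q01 0 ls pf f ∧ LRun (A := A) w A.q02 (w.length + 1) ls qf g ∧
    (evs ls).length ≤ K ∧ G (evs ls).length pf (tape w f) qf (tape w g)

def NV (K a b a' b' : ℕ) : ℕ :=
  4 * (((a * (K + 1) + 1) * (b * (K + 1) + 1)) * ((a' * (K + 1) + 1) * (b' * (K + 1) + 1)))

def BB (K a b a' b' : ℕ) : ℕ := GB (2 * K + 2) (NV K a b a' b') 4

lemma sys_fwd {K x : ℕ} {w : List Bool} {ls pf f qf g}
    (hU : URun (A := A) w A.q01 0 ls pf f) (hL : LRun (A := A) w A.q02 (w.length + 1) ls qf g)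
    (hK : (evs ls).length ≤ K) :
    ∃ v, (∀ i, v i = 0) ∧ Run ((upT A (evs ls) K (wtp x 1) pf (tape w f)).prod
      (loT A (evs ls) K (wtp x (-1)) qf (tape w g))) (Sum.inr false) (some (A.q01, 0), none)
      (rest w 0) (Sum.inr true) (none, some (A.q02, 0)) v := by
  have h1 := up_fwd hK (wtp x 1) hU 0 (by simp) (by simp)
  have h2 := lo_fwd hK (wtp x (-1)) hL le_rfl 0 (by simp) (by simp)
  rw [tape_zero] at h1
  rw [tape_end w _ le_rfl, List.take_of_length_le (by simp [rest])] at h2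
  refine ⟨_, ?_, Run.prod_mk h1 h2⟩
  intro i
  exact Wsum_neg x ls _ i

lemma sys_bwd {K x : ℕ} {w : List Bool} {E : List (Lb A)} {pf af qf bf v} {D : ℕ} 
    (hK : E.length ≤ K)
    (h : Run ((upT A E K (wtp x 1) pf af).prod
      (loT A E K (wtp x (-1)) qf bf)) (Sum.inr false) (some (A.q01, 0), none)
      (rest w 0) (Sum.inr true) (none, some (A.q02, 0)) v) :
    (∀ y i, x % 2 ≠ y % 2 → v (2 * i + y) = 0) ∧
    ((∀ i ≤ K, v (2 * i + x) = 0) → 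
     ∃ ls f g, URun (A := A) w A.q01 0 ls pf f ∧ LRun (A := A) w A.q02 (w.length + 1) ls qf g ∧
      evs ls = E ∧ tape w f = af ∧ tape w g = bf) := by
  obtain ⟨v1, v2, rfl, h1, h2⟩ := h.prod_fst
  obtain ⟨ls, f, k1, k2, k3, rfl⟩ := up_bwd (w := w) h1 A.q01 0 0 rfl rfl (tape_zero w).symm rfl
  obtain ⟨ls', g, m1, m2, m3, m4⟩ := lo_bwd (w := w) h2 0 0 (by simp) (tape_zero w).symm rfl rfl
  rw [zero_add] at m4
  subst m4
  simp only [Fin.val_zero, List.drop_zero] at k3 m3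
  constructor
  · intro y i hxy
    simp [Wsum_other _ _ _ _ _ _ hxy]
  · intro hv
    have : ls = ls' := by
      apply labels_eq ls ls' 0 (by rw [k3, m3])
      intro i hi
      have := hv i (by rw [k3] at hi; omega)
      simp only [Pi.add_apply, Wsum_cnt, Fin.val_zero] at this
      omega
    subst this
    exact ⟨ls, f, g, k1, m1, k3, k2, m2⟩

theorem cert_pump (A A' : DPWK Bool) (K : ℕ) (G : ℕ → A.Q1 → Sy → A.Q2 → Sy → Prop)
    (G' : ℕ → A'.Q1 → Sy → A'.Q2 → Sy → Prop) (a b a' b' : ℕ) (ha : Nat.card A.Q1 = a)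
    (hb : Nat.card A.Q2 = b) (ha' : Nat.card A'.Q1 = a') (hb' : Nat.card A'.Q2 = b')
    (w : List Bool) (h : Cert A K G w) (h' : Cert A' K G' w) :
    ∃ L0 ≤ BB K a b a' b', ∃ C ≤ BB K a b a' b', (BB K a b a' b' < w.length + 1 → 0 < C) ∧
      ∀ n : ℕ, ∃ w', Cert A K G w' ∧ Cert A' K G' w' ∧ w'.length + 1 = L0 + n * C := by
  letI := A.fQ1
  letI := A.fQ2
  letI := A'.fQ1
  letI := A'.fQ2
  obtain ⟨ls, pf, f, qf, g, hU, hL, hK, hG⟩ := h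
  obtain ⟨ls', pf', f', qf', g', hU', hL', hK', hG'⟩ := h'
  obtain ⟨v, hv, hr⟩ := sys_fwd (x := 0) hU hL hK
  obtain ⟨v', hv', hr'⟩ := sys_fwd (x := 1) hU' hL' hK'
  have hrun := Run.prod_mk hr hr'
  have hbd := ((upT_bdd (A := A) (E := evs ls) (K := K) (wtp_bdd 0 1 (by simp)) 
      (pf := pf) (af := tape w f)).prod
    (loT_bdd (E := evs ls) (K := K) (wtp_bdd 0 (-1) (by simp)) (pf := qf) (af := tape w g))).prod
    ((upT_bdd (A := A') (E := evs ls') (K := K) (wtp_bdd 1 1 (by simp)) 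
      (pf := pf') (af := tape w f')).prod
    (loT_bdd (E := evs ls') (K := K) (wtp_bdd 1 (-1) (by simp)) (pf := qf') (af := tape w g')))
  obtain ⟨L0, h0, C, hC, hpos, hmain⟩ := track_pump _ (2 * K + 2) _ hbd (NV K a b a' b') (by
    apply le_of_eq
    rw [Nat.card_eq_fintype_card] at ha hb ha' hb'
    simp [NV, ha, hb, ha', hb', Sy, TSym]) hrun (by intro i _; simp [hv, hv'])
  refine ⟨L0, h0, C, hC, ?_, ?_⟩
  · intro hlt
    apply hpos
    simpa [rest, BB] using hlt
  · intro n
    obtain ⟨l, u, hl, hz, hlen⟩ := hmain n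
    obtain ⟨u1, u2, rfl, r1, r2⟩ := hl.prod_fst
    obtain ⟨_, _, _, r11, _⟩ := r1.prod_fst
    rcases up_word r11 rfl with ⟨h, _⟩ | ⟨_, w', rfl⟩
    · cases h
    have hrest : (w'.map Sum.inl ++ [Sum.inr true] : List Sy) = rest w' 0 := by simp [rest]
    rw [hrest] at r1 r2
    obtain ⟨z1, s1⟩ := sys_bwd (D := 0) hK r1
    obtain ⟨z2, s2⟩ := sys_bwd (D := 0) hK' r2
    obtain ⟨L, F, Gg, x1, x2, x3, x4, x5⟩ := s1 (by
      intro i hi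
      have e1 := hz (2 * i + 0) (by omega)
      have e2 := z2 0 i (by simp)
      simp only [Pi.add_apply] at e1
      omega)
    obtain ⟨L', F', Gg', y1, y2, y3, y4, y5⟩ := s2 (by
      intro i hi
      have e1 := hz (2 * i + 1) (by omega)
      have e2 := z1 1 i (by simp)
      simp only [Pi.add_apply] at e1
      omega)
    refine ⟨w', ⟨L, pf, F, qf, Gg, x1, x2, by rw [x3]; exact hK, by rw [x3, x4, x5]; exact hG⟩,
      ⟨L', pf', F', qf', Gg', y1, y2, by rw [y3]; exact hK', by rw [y3, y4, y5]; exact hG'⟩, ?_⟩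
    rw [← hlen]; simp

end
end WKP

namespace WKP
open WK

section
variable {A : DPWK Bool}

def lab (w : List Bool) (c : Config A) : Lb A :=
  (A.μ1 c.p (tape w c.i), A.μ2 c.q (tape w c.j))

inductive SRun (w : List Bool) : Config A → List (Lb A) → Config A → Prop
  | nil (c) : SRun w c [] c
  | cons {c c' ls d} : Step A w c c' → SRun w c' ls d → SRun w c (lab w c :: ls) d

lemma Step.det {w : List Bool} {c c1 c2 : Config A} (h1 : Step A w c c1) (h2 : Step A w c c2) :
    c1 = c2 := by
  obtain ⟨d1, d2, a1, a2, a3, a4⟩ := h1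
  obtain ⟨e1, e2, b1, b2, b3, b4⟩ := h2
  rw [a1] at b1
  rw [a2] at b2
  rcases c1 with ⟨p, i, q, j⟩
  rcases c2 with ⟨p', i', q', j'⟩
  simp only [Option.some.injEq, Prod.mk.injEq] at *
  obtain ⟨rfl, rfl⟩ := b1
  obtain ⟨rfl, rfl⟩ := b2
  simp only [Config.mk.injEq, true_and]
  omega

lemma SRun.toU {w : List Bool} {c d : Config A} {ls} (h : SRun w c ls d) :
    URun (A := A) w c.p c.i ls d.p d.i := by
  induction h with
  | nil c => exact URun.nil _ _
  | cons hs _ ih =>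
    obtain ⟨d1, d2, a1, a2, a3, a4⟩ := hs
    rw [a3] at ih
    exact URun.cons ⟨rfl, a1⟩ ih

lemma SRun.toL {w : List Bool} {c d : Config A} {ls} (h : SRun w c ls d) :
    LRun (A := A) w c.q c.j ls d.q d.j := by
  induction h with
  | nil c => exact LRun.nil _ _
  | cons hs _ ih =>
    obtain ⟨d1, d2, a1, a2, a3, a4⟩ := hs
    exact LRun.cons ⟨rfl, a2⟩ a4 ih

lemma SRun.of {w : List Bool} {p i ls pf f} (h : URun (A := A) w p i ls pf f) :
    ∀ {q j qf g}, LRun (A := A) w q j ls qf g → SRun (A := A) w ⟨p, i, q, j⟩ ls ⟨pf, f, qf, g⟩ := by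
  induction h with
  | nil p i =>
    intro q j qf g h
    cases h
    exact SRun.nil _
  | @cons p i lb p' d ls pf f hs _ ih =>
    intro q j qf g h
    cases h with
    | @cons _ _ j' _ q' d' _ _ _ hs' hj h' =>
      have hl : lb = lab w (⟨p, i, q, j⟩ : Config A) := by
        rcases lb with ⟨x, y⟩
        simp only [lab, hs.1, hs'.1]
      have st : Step A w ⟨p, i, q, j⟩ ⟨p', i + cond d 1 0, q', j'⟩ := by
        refine ⟨d, d', ?_, ?_, rfl, hj⟩
        · simpa [hs'.1] using hs.2
        · simpa [hs.1] using hs'.2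
      have := SRun.cons st (ih h')
      rw [← hl] at this
      exact this

lemma SRun.append {w : List Bool} {c d e : Config A} {ls ls'} (h : SRun w c ls d)
    (h' : SRun w d ls' e) : SRun w c (ls ++ ls') e := by
  induction h with
  | nil c => exact h'
  | cons hs _ ih => exact SRun.cons hs (ih h')

lemma SRun.det {w : List Bool} {c d : Config A} {ls} (h : SRun w c ls d) :
    ∀ {ls' d'}, SRun w c ls' d' → Halted A w d' → ∃ ls'', ls' = ls ++ ls'' ∧ SRun w d ls'' d' := by
  induction h with
  | nil c => intro ls' d' h _; exact ⟨ls', rfl, h⟩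
  | cons hs _ ih =>
    intro ls' d' h hh
    cases h with
    | nil => exact absurd ⟨_, hs⟩ hh
    | cons hs' h' =>
      obtain rfl := Step.det hs hs'
      obtain ⟨ls'', rfl, h2⟩ := ih h' hh
      exact ⟨ls'', rfl, h2⟩

lemma SRun.halted {w : List Bool} {c d : Config A} {ls} (h : SRun w c ls d) (hh : Halted A w c) :
    ls = [] ∧ d = c := by
  cases h with
  | nil => exact ⟨rfl, rfl⟩
  | cons hs _ => exact absurd ⟨_, hs⟩ hh

lemma SRun.of_chain {w : List Bool} (cs : List (Config A)) : ∀ c d, cs.head? = some c →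
    List.IsChain (Step A w) cs → cs.getLast? = some d →
    ∃ ls, SRun w c ls d ∧ (evs ls).length ≤ commCount A A.μ1 A.μ2 w cs := by
  induction cs with
  | nil => intro c d h; cases h
  | cons x cs ih =>
    intro c d h1 h2 h3
    cases h1
    cases cs with
    | nil =>
      simp at h3
      subst h3
      exact ⟨[], SRun.nil _, by simp [evs]⟩
    | cons y cs =>
      rw [List.isChain_cons_cons] at h2
      obtain ⟨ls, h4, h5⟩ := ih y d rfl h2.2 (by simpa using h3)
      refine ⟨_, SRun.cons h2.1 h4, ?_⟩
      have e1 : commCount A A.μ1 A.μ2 w (x :: y :: cs) =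
          stepMsgs A A.μ1 A.μ2 w x + commCount A A.μ1 A.μ2 w (y :: cs) := by
        simp [commCount]
      rw [e1]
      have e2 : (evs (lab w x :: ls)).length ≤ stepMsgs A A.μ1 A.μ2 w x + (evs ls).length := by
        simp only [evs, List.filter_cons, stepMsgs]
        split_ifs with hev
        · simp only [ev, lab] at hev
          rw [List.length_cons]
          cases h1 : A.μ1 x.p (tape w x.i) <;> cases h2 : A.μ2 x.q (tape w x.j) <;>
            simp_all <;> omega
        · omega
      omega

lemma SRun.to_chain {w : List Bool} {c d : Config A} {ls} (h : SRun w c ls d) :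
    ∃ cs, cs.head? = some c ∧ List.IsChain (Step A w) cs ∧ cs.getLast? = some d := by
  induction h with
  | nil c => exact ⟨[c], rfl, by simp, by simp⟩
  | @cons c c' ls d hs _ ih =>
    obtain ⟨cs, h1, h2, h3⟩ := ih
    cases cs with
    | nil => cases h1
    | cons x cs =>
      cases h1
      exact ⟨c :: c' :: cs, rfl, by rw [List.isChain_cons_cons]; exact ⟨hs, h2⟩, by simpa using h3⟩

lemma mem_lang {w : List Bool} : w ∈ lang A ↔
    ∃ ls d, SRun w (initConf A w) ls d ∧ Halted A w d ∧ AccConf A d := by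
  constructor
  · rintro ⟨cs, h1, h2, c, h3, h4, h5⟩
    obtain ⟨ls, h6, _⟩ := SRun.of_chain cs _ _ h1 h2 h3
    exact ⟨ls, c, h6, h4, h5⟩
  · rintro ⟨ls, d, h1, h2, h3⟩
    obtain ⟨cs, h4, h5, h6⟩ := h1.to_chain
    exact ⟨cs, h4, h5, d, h6, h2, h3⟩

lemma comm_le {k : ℕ} (hA : CommBounded A (fun _ => k)) {w : List Bool} {ls d}
    (h1 : SRun w (initConf A w) ls d) (h2 : Halted A w d) (h3 : AccConf A d) :
    (evs ls).length ≤ k := by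
  obtain ⟨cs, ⟨h4, h5, c, h6, h7, h8⟩, h9⟩ := hA w (mem_lang.2 ⟨ls, d, h1, h2, h3⟩)
  obtain ⟨ls', h10, h11⟩ := SRun.of_chain cs _ _ h4 h5 h6
  obtain ⟨l2, e, h12⟩ := h10.det h1 h2
  obtain ⟨rfl, _⟩ := h12.halted h7
  rw [e, List.append_nil]
  exact h11.trans h9

lemma step_local {w w' : List Bool} {p i q j i' j'} {c1 : Config A} (hi : tape w i = tape w' i')
    (hj : tape w j = tape w' j') (h : Step A w ⟨p, i, q, j⟩ c1) :
    ∃ c1', Step A w' ⟨p, i', q, j'⟩ c1' ∧ c1'.p = c1.p ∧ c1'.q = c1.q ∧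
      c1'.i + i = c1.i + i' ∧ c1'.j + j = c1.j + j' := by
  obtain ⟨d1, d2, a1, a2, a3, a4⟩ := h
  simp only at a1 a2 a3 a4
  rw [hi, hj] at a1 a2
  have hz : j = 0 ↔ j' = 0 := by rw [← tape_eq_left w j, ← tape_eq_left w' j', hj]
  refine ⟨⟨c1.p, i' + cond d1 1 0, c1.q, j' - cond d2 1 0⟩, ⟨d1, d2, a1, a2, rfl, ?_⟩, rfl, rfl, ?_, ?_⟩
  · cases d2 <;> simp at a4 ⊢; omega
  · simp only [a3]; omega
  · cases d2 <;> simp at a4 ⊢ <;> omega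

lemma halted_local {w w' : List Bool} {p i q j i' j'} (hi : tape w i = tape w' i')
    (hj : tape w j = tape w' j') (h : Halted A w ⟨p, i, q, j⟩) : Halted A w' ⟨p, i', q, j'⟩ := by
  rintro ⟨c, hc⟩
  obtain ⟨c', hc', _⟩ := step_local hi.symm hj.symm hc
  exact h ⟨c', hc'⟩

variable (A) in
def Gacc (_ : ℕ) (p : A.Q1) (a : Sy) (q : A.Q2) (b : Sy) : Prop :=
  ∀ w i j, tape w i = a → tape w j = b → Halted A w ⟨p, i, q, j⟩ ∧ AccConf A ⟨p, i, q, j⟩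

variable (A) in
def Grej (k : ℕ) (R : ℕ) (p : A.Q1) (a : Sy) (q : A.Q2) (b : Sy) : Prop :=
  R = k + 1 ∨ ∀ w i j, tape w i = a → tape w j = b →
    ¬ ∃ ls d, SRun (A := A) w ⟨p, i, q, j⟩ ls d ∧ Halted A w d ∧ AccConf A d

lemma cert_of {K : ℕ} {G} {w : List Bool} {ls} {d : Config A} (h : SRun w (initConf A w) ls d)
    (hK : (evs ls).length ≤ K) (hG : G (evs ls).length d.p (tape w d.i) d.q (tape w d.j)) :
    Cert A K G w := ⟨ls, d.p, d.i, d.q, d.j, h.toU, h.toL, hK, hG⟩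

lemma Cert.srun {K : ℕ} {G} {w : List Bool} (h : Cert A K G w) :
    ∃ ls d, SRun w (initConf A w) ls d ∧ (evs ls).length ≤ K ∧
      G (evs ls).length d.p (tape w d.i) d.q (tape w d.j) := by
  obtain ⟨ls, pf, f, qf, g, h1, h2, h3, h4⟩ := h
  exact ⟨ls, _, SRun.of h1 h2, h3, h4⟩

lemma cert_true (K : ℕ) (w : List Bool) : Cert A K (fun _ _ _ _ _ => True) w :=
  cert_of (SRun.nil _) (by simp [evs]) trivial

lemma cert_acc {k : ℕ} (hA : CommBounded A (fun _ => k)) (w : List Bool) :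
    w ∈ lang A ↔ Cert A (k + 1) (Gacc A) w := by
  rw [mem_lang]
  constructor
  · rintro ⟨ls, d, h1, h2, h3⟩
    refine cert_of h1 (by have := comm_le hA h1 h2 h3; omega) ?_
    intro w' i j hi hj
    exact ⟨halted_local hi.symm hj.symm h2, h3⟩
  · intro h
    obtain ⟨ls, d, h1, _, h2⟩ := h.srun
    obtain ⟨h3, h4⟩ := h2 w d.i d.j rfl rfl
    exact ⟨ls, d, h1, h3, h4⟩

lemma SRun.take_events {w : List Bool} {c d : Config A} {ls} (h : SRun w c ls d) :
    ∀ n ≤ (evs ls).length, ∃ ls' d', SRun w c ls' d' ∧ (evs ls').length = n := by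
  induction h with
  | nil c => intro n hn; exact ⟨[], c, SRun.nil _, by simp [evs] at hn ⊢; omega⟩
  | @cons c c' ls d hs _ ih =>
    intro n hn
    by_cases he : ev (lab w c) = true
    · rcases n with _ | n
      · exact ⟨[], c, SRun.nil _, by simp [evs]⟩
      · obtain ⟨l, e, h1, h2⟩ := ih n (by simp [evs, he] at hn ⊢; omega)
        refine ⟨_, e, SRun.cons hs h1, ?_⟩
        simp [evs, he] at h2 ⊢
        omega
    · obtain ⟨l, e, h1, h2⟩ := ih n (by simpa [evs, he] using hn)
      refine ⟨_, e, SRun.cons hs h1, ?_⟩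
      simpa [evs, he] using h2

lemma SRun.mono {w : List Bool} {c d : Config A} {ls} (h : SRun w c ls d) :
    c.i ≤ d.i ∧ d.j ≤ c.j := by
  induction h with
  | nil c => simp
  | cons hs _ ih =>
    obtain ⟨d1, d2, a1, a2, a3, a4⟩ := hs
    omega

lemma exists_stuck {w : List Bool} (c : Config A) (hc : c.j ≤ w.length + 1) :
    ∃ ls d, SRun w c ls d ∧ ∀ ls' d', SRun w d ls' d' →
      d'.j = d.j ∧ (d'.i = d.i ∨ w.length + 1 ≤ d.i) := by
  generalize hm : (w.length + 1 - c.i) + c.j = m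
  induction m using Nat.strong_induction_on generalizing c with
  | _ m ih =>
    by_cases h : ∀ ls' d', SRun w c ls' d' → d'.j = c.j ∧ (d'.i = c.i ∨ w.length + 1 ≤ c.i)
    · exact ⟨[], c, SRun.nil _, h⟩
    · push Not at h
      obtain ⟨l, d, h1, h2⟩ := h
      have hm := h1.mono
      obtain ⟨ls, e, h3, h4⟩ := ih ((w.length + 1 - d.i) + d.j) (by
        by_cases h5 : d.j = c.j
        · have := h2 h5; omega
        · omega) d (by omega) rfl
      exact ⟨_, e, h1.append h3, h4⟩

lemma stuck_sim {w w' : List Bool} {d : Config A}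
    (hd : ∀ ls' d', SRun w d ls' d' → d'.j = d.j ∧ (d'.i = d.i ∨ w.length + 1 ≤ d.i))
    {c' e' : Config A} {ls'} (h' : SRun w' c' ls' e') : ∀ ls c, SRun w d ls c → c.p = c'.p →
    c.q = c'.q → tape w c.i = tape w' c'.i → tape w c.j = tape w' c'.j →
    ∃ ls e, SRun w d ls e ∧ e.p = e'.p ∧ e.q = e'.q ∧ tape w e.i = tape w' e'.i ∧
      tape w e.j = tape w' e'.j := by
  induction h' with
  | nil c' => intro ls c h1 h2 h3 h4 h5; exact ⟨ls, c, h1, h2, h3, h4, h5⟩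
  | @cons c' c1' ls' e' hs _ ih =>
    intro ls c h1 h2 h3 h4 h5
    rcases c with ⟨p, i, q, j⟩
    rcases c' with ⟨p', i', q', j'⟩
    simp only at h2 h3 h4 h5
    subst h2 h3
    obtain ⟨c1, hs1, k1, k2, k3, k4⟩ := step_local h4.symm h5.symm hs
    have h6 := h1.append (SRun.cons hs1 (SRun.nil _))
    have m1 := h1.mono
    have m2 := (SRun.cons hs1 (SRun.nil _)).mono
    obtain ⟨n1, n2⟩ := hd _ _ h1
    obtain ⟨n3, n4⟩ := hd _ _ h6
    simp only at m1 m2 n1 n2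
    refine ih _ c1 h6 k1 k2 ?_ ?_
    · by_cases hh : c1.i = i
      · have : c1'.i = i' := by omega
        rw [hh, this, h4]
      · have h7 : w.length + 1 ≤ i := by omega
        have h8 : w'.length + 1 ≤ i' := by
          rw [← tape_eq_right, ← h4, tape_eq_right]; exact h7
        rw [tape_end w _ (by omega), tape_end w' _ (by omega)]
    · have e1 : c1.j = j := by omega
      have e2 : c1'.j = j' := by omega
      rw [e1, e2, h5]

lemma cert_rej {k : ℕ} (hA : CommBounded A (fun _ => k)) (w : List Bool) :
    w ∉ lang A ↔ Cert A (k + 1) (Grej A k) w := by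
  constructor
  · intro hw
    by_cases h1 : ∃ ls d, SRun w (initConf A w) ls d ∧ k + 1 ≤ (evs ls).length
    · obtain ⟨ls, d, h2, h3⟩ := h1
      obtain ⟨l, e, h4, h5⟩ := h2.take_events (k + 1) h3
      exact cert_of h4 (by omega) (Or.inl h5)
    push Not at h1
    by_cases h2 : ∃ ls d, SRun w (initConf A w) ls d ∧ Halted A w d
    · obtain ⟨ls, d, h3, h4⟩ := h2
      refine cert_of h3 (h1 _ _ h3).le (Or.inr ?_)
      rintro w' i j hi hj ⟨l, e, h5, h6, h7⟩
      obtain ⟨_, rfl⟩ := h5.halted (halted_local hi.symm hj.symm h4)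
      exact hw (mem_lang.2 ⟨ls, d, h3, h4, h7⟩)
    · push Not at h2
      obtain ⟨ls, d, h3, h4⟩ := exists_stuck (w := w) (initConf A w) (by simp [initConf])
      refine cert_of h3 (h1 _ _ h3).le (Or.inr ?_)
      rintro w' i j hi hj ⟨l, e, h5, h6, h7⟩
      obtain ⟨l2, e2, k1, k2, k3, k4, k5⟩ :=
        stuck_sim h4 h5 [] d (SRun.nil _) rfl rfl hi.symm hj.symm
      apply h2 _ _ (h3.append k1)
      rcases e with ⟨p, i, q, j⟩
      rcases e2 with ⟨p', i', q', j'⟩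
      simp only at k2 k3 k4 k5
      subst k2 k3
      exact halted_local k4.symm k5.symm h6
  · intro h hw
    obtain ⟨ls, d, h1, h2, h3⟩ := h.srun
    obtain ⟨l, e, h4, h5, h6⟩ := mem_lang.1 hw
    obtain ⟨l2, rfl, h7⟩ := h1.det h4 h5
    rcases h3 with h3 | h3
    · have := comm_le hA h4 h5 h6
      simp [evs] at this h3
      omega
    · exact h3 w d.i d.j rfl rfl ⟨l2, e, h7, h5, h6⟩

/-- bound used for all decision procedures -/
theorem small_diff (A A' : DPWK Bool) (k : ℕ) (hA : CommBounded A (fun _ => k))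
    (hA' : CommBounded A' (fun _ => k)) (a b a' b' : ℕ) (ha : Nat.card A.Q1 = a)
    (hb : Nat.card A.Q2 = b) (ha' : Nat.card A'.Q1 = a') (hb' : Nat.card A'.Q2 = b') :
    lang A ⊆ lang A' ↔ ∀ w : List Bool, w.length ≤ BB (k + 1) a b a' b' → w ∈ lang A → w ∈ lang A' := by
  constructor
  · intro h w _ hw; exact h hw
  · intro h w hw
    by_contra hc
    obtain ⟨L0, hL, C, hC, _, hm⟩ := cert_pump A A' (k + 1) (Gacc A) (Grej A' k) a b a' b' ha hb ha' hb' w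
      ((cert_acc hA w).1 hw) ((cert_rej hA' w).1 hc)
    obtain ⟨w', h1, h2, h3⟩ := hm 0
    exact (cert_rej hA' w').2 h2 (h w' (by omega) ((cert_acc hA w').2 h1))

theorem small_empty (A : DPWK Bool) (k : ℕ) (hA : CommBounded A (fun _ => k))
    (a b : ℕ) (ha : Nat.card A.Q1 = a) (hb : Nat.card A.Q2 = b) :
    lang A = ∅ ↔ ∀ w : List Bool, w.length ≤ BB (k + 1) a b a b → w ∉ lang A := by
  constructor
  · intro h w _ hw; rw [h] at hw; exact hw
  · intro h
    rw [Set.eq_empty_iff_forall_notMem]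
    intro w hw
    obtain ⟨L0, hL, C, hC, _, hm⟩ := cert_pump A A (k + 1) (Gacc A) _ a b a b ha hb ha hb w
      ((cert_acc hA w).1 hw) (cert_true _ w)
    obtain ⟨w', h1, h2, h3⟩ := hm 0
    exact h w' (by omega) ((cert_acc hA w').2 h1)

theorem small_fin (A : DPWK Bool) (k : ℕ) (hA : CommBounded A (fun _ => k))
    (a b : ℕ) (ha : Nat.card A.Q1 = a) (hb : Nat.card A.Q2 = b) :
    (lang A).Finite ↔ ∀ w : List Bool, w.length ≤ 2 * BB (k + 1) a b a b →
      BB (k + 1) a b a b < w.length + 1 → w ∉ lang A := by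
  constructor
  · intro h w _ hB hw
    obtain ⟨L0, hL, C, hC, hpos, hm⟩ := cert_pump A A (k + 1) (Gacc A) _ a b a b ha hb ha hb w
      ((cert_acc hA w).1 hw) (cert_true _ w)
    have hp := hpos hB
    obtain ⟨N, hN⟩ := (h.image List.length).bddAbove
    obtain ⟨w', h1, h2, h3⟩ := hm (N + 2)
    have := hN (Set.mem_image_of_mem List.length ((cert_acc hA w').2 h1))
    have : N + 2 ≤ (N + 2) * C := Nat.le_mul_of_pos_right _ hp
    omega
  · intro h
    apply (List.finite_length_le Bool (BB (k + 1) a b a b)).subset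
    intro w hw
    by_contra hc
    simp only [Set.mem_setOf_eq, not_le] at hc
    obtain ⟨L0, hL, C, hC, hpos, hm⟩ := cert_pump A A (k + 1) (Gacc A) _ a b a b ha hb ha hb w
      ((cert_acc hA w).1 hw) (cert_true _ w)
    have hp := hpos (by omega)
    generalize BB (k + 1) a b a b = B at *
    have hex : ∃ n, B < L0 + n * C := ⟨B + 1, by
      have : B + 1 ≤ (B + 1) * C := Nat.le_mul_of_pos_right _ hp
      omega⟩
    classical
    let n := Nat.find hex
    have hn : B < L0 + n * C := Nat.find_spec hex
    have hn2 : L0 + n * C ≤ 2 * B := by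
      rcases Nat.eq_zero_or_pos n with h0 | h0
      · rw [h0] at hn; omega
      · have := Nat.find_min hex (m := n - 1) (Nat.sub_lt h0 one_pos)
        obtain ⟨m, hm⟩ : ∃ m, n = m + 1 := ⟨n - 1, by omega⟩
        rw [hm] at this ⊢
        simp only [Nat.add_sub_cancel] at this
        rw [Nat.succ_mul]
        omega
    obtain ⟨w', h1, h2, h3⟩ := hm n
    exact h w' (by omega) (by omega) ((cert_acc hA w').2 h1)

end
end WKP

namespace WKP
open WK

section
variable {X : Type} [Primcodable X]

def tIdx (w : List Bool) (i : ℕ) : ℕ :=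
  ((2 :: w.map (fun b => cond b 1 0)) ++ [3]).getD i 3

lemma tIdx_eq (w : List Bool) (i : ℕ) : tIdx w i = symIdx (tape w i) := by
  have : ((2 :: w.map (fun b => cond b 1 0)) ++ [3] : List ℕ) =
      ((Sum.inr false :: w.map Sum.inl) ++ [Sum.inr true] : List Sy).map symIdx := by
    simp only [List.map_append, List.map_cons, List.map_map, List.map_nil, symIdx]
    congr 3
    funext b
    cases b <;> rfl
  rw [tIdx, this, tape, show (3 : ℕ) = symIdx (Sum.inr true) from rfl, List.getD_map]

lemma tIdx_prim {f : X → List Bool} {g : X → ℕ} (hf : Primrec f) (hg : Primrec g) :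
    Primrec fun x => tIdx (f x) (g x) :=
  (Primrec.list_getD 3).comp (Primrec.list_append.comp (Primrec.list_cons.comp (Primrec.const 2)
    (Primrec.list_map hf ((Primrec.dom_bool (fun b => cond b 1 0)).comp Primrec.snd).to₂))
      (Primrec.const [3])) hg

def muN (u : List (Option ℕ)) (m idx : ℕ) : ℕ :=
  ((u.getD idx none).map fun x => x % (m + 1) + 1).getD 0

lemma muN_eq (u : List (Option ℕ)) (m idx : ℕ) :
    muN u m idx = msgIdx ((u.getD idx none).map (toFin m)) := by
  unfold muN
  cases u.getD idx none <;> simp [msgIdx, toFin]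

lemma muN_prim {f : X → List (Option ℕ)} {g h : X → ℕ} (hf : Primrec f) (hg : Primrec g)
    (hh : Primrec h) : Primrec fun x => muN (f x) (g x) (h x) :=
  Primrec.option_getD.comp (Primrec.option_map ((Primrec.list_getD none).comp hf hh)
    (Primrec.succ.comp (Primrec.nat_mod.comp Primrec.snd
      (Primrec.succ.comp (hg.comp Primrec.fst)))).to₂) (Primrec.const 0)

abbrev St := (ℕ × ℕ) × (ℕ × ℕ)

def e1 (d : Desc) (w : List Bool) (s : St) : Option (ℕ × Bool) :=
  d.2.1.1.getD ((s.1.1 * 4 + tIdx w s.1.2) * (d.1.1 + 2) +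
    muN d.2.2.1.2 d.1.1 (s.2.1 * 4 + tIdx w s.2.2)) none

def e2 (d : Desc) (w : List Bool) (s : St) : Option (ℕ × Bool) :=
  d.2.1.2.getD ((s.2.1 * 4 + tIdx w s.2.2) * (d.1.1 + 2) +
    muN d.2.2.1.1 d.1.1 (s.1.1 * 4 + tIdx w s.1.2)) none

def fin (d : Desc) (w : List Bool) (s : St) (a b : ℕ × Bool) : Option St :=
  if b.2 = true ∧ s.2.2 = 0 then none else
    some ((a.1 % (d.1.2.1 + 1), min (s.1.2 + cond a.2 1 0) (w.length + 1)),
      (b.1 % (d.1.2.2 + 1), s.2.2 - cond b.2 1 0))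

def stepN (d : Desc) (w : List Bool) (s : St) : Option St :=
  (e1 d w s).bind fun a => (e2 d w s).bind fun b => fin d w s a b

section
open Primrec
lemma pr_lin {f g h : X → ℕ} (hf : Primrec f) (hg : Primrec g) (hh : Primrec h) :
    Primrec fun x => f x * g x + h x := nat_add.comp (nat_mul.comp hf hg) hh

lemma e1_prim {D : X → Desc} {W : X → List Bool} {S : X → St} (hD : Primrec D) (hW : Primrec W)
    (hS : Primrec S) : Primrec fun x => e1 (D x) (W x) (S x) := by
  have p := fst.comp (fst.comp hS)
  have i := snd.comp (fst.comp hS)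
  have q := fst.comp (snd.comp hS)
  have j := snd.comp (snd.comp hS)
  have m : Primrec fun x => (D x).1.1 := fst.comp (fst.comp hD)
  have t1 : Primrec fun x => (D x).2.1.1 := fst.comp (fst.comp (snd.comp hD))
  have u2 : Primrec fun x => (D x).2.2.1.2 := snd.comp (fst.comp (snd.comp (snd.comp hD)))
  exact (list_getD none).comp t1 (pr_lin (pr_lin p (const 4) (tIdx_prim hW i))
    (nat_add.comp m (const 2)) (muN_prim u2 m (pr_lin q (const 4) (tIdx_prim hW j))))

lemma e2_prim {D : X → Desc} {W : X → List Bool} {S : X → St} (hD : Primrec D) (hW : Primrec W)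
    (hS : Primrec S) : Primrec fun x => e2 (D x) (W x) (S x) := by
  have p := fst.comp (fst.comp hS)
  have i := snd.comp (fst.comp hS)
  have q := fst.comp (snd.comp hS)
  have j := snd.comp (snd.comp hS)
  have m : Primrec fun x => (D x).1.1 := fst.comp (fst.comp hD)
  have t1 : Primrec fun x => (D x).2.1.2 := snd.comp (fst.comp (snd.comp hD))
  have u2 : Primrec fun x => (D x).2.2.1.1 := fst.comp (fst.comp (snd.comp (snd.comp hD)))
  exact (list_getD none).comp t1 (pr_lin (pr_lin q (const 4) (tIdx_prim hW j))
    (nat_add.comp m (const 2)) (muN_prim u2 m (pr_lin p (const 4) (tIdx_prim hW i))))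

lemma fin_prim {D : X → Desc} {W : X → List Bool} {S : X → St} {a b : X → ℕ × Bool}
    (hD : Primrec D) (hW : Primrec W)
    (hS : Primrec S) (ha : Primrec a) (hb : Primrec b) :
    Primrec fun x => fin (D x) (W x) (S x) (a x) (b x) := by
  have i := snd.comp (fst.comp hS)
  have j := snd.comp (snd.comp hS)
  have n1 : Primrec fun x => (D x).1.2.1 := fst.comp (snd.comp (fst.comp hD))
  have n2 : Primrec fun x => (D x).1.2.2 := snd.comp (snd.comp (fst.comp hD))
  refine Primrec.ite ((Primrec.eq.comp (snd.comp hb) (const true)).and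
    (Primrec.eq.comp j (const 0))) (const none) (option_some.comp (Primrec.pair
      (Primrec.pair ?_ ?_) (Primrec.pair ?_ ?_)))
  · exact nat_mod.comp (fst.comp ha) (succ.comp n1)
  · exact nat_min.comp (nat_add.comp i ((dom_bool fun b => cond b 1 0).comp (snd.comp ha)))
      (succ.comp (list_length.comp hW))
  · exact nat_mod.comp (fst.comp hb) (succ.comp n2)
  · exact nat_sub.comp j ((dom_bool fun b => cond b 1 0).comp (snd.comp hb))

lemma stepN_prim {D : X → Desc} {W : X → List Bool} {S : X → St} (hD : Primrec D) (hW : Primrec W)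
    (hS : Primrec S) : Primrec fun x => stepN (D x) (W x) (S x) := by
  refine option_bind (e1_prim hD hW hS) ?_
  refine option_bind (e2_prim (hD.comp fst) (hW.comp fst) (hS.comp fst)) ?_
  exact fin_prim (hD.comp (fst.comp fst)) (hW.comp (fst.comp fst)) (hS.comp (fst.comp fst))
    (snd.comp fst) snd
end

def sim (d : Desc) (w : List Bool) (s : St) : St := (stepN d w s).getD s

def iniN (d : Desc) (w : List Bool) : St :=
  ((d.2.2.2.1.1 % (d.1.2.1 + 1), 0), (d.2.2.2.1.2 % (d.1.2.2 + 1), w.length + 1))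

def bndN (d : Desc) (w : List Bool) : ℕ :=
  ((d.1.2.1 + 1) * (w.length + 2)) * ((d.1.2.2 + 1) * (w.length + 2))

def finN (d : Desc) (w : List Bool) : St := (sim d w)^[bndN d w] (iniN d w)

def AccN (w : List Bool) (d : Desc) : Prop :=
  stepN d w (finN d w) = none ∧ ((∃ x ∈ d.2.2.2.2.1, x = (finN d w).1.1) ∨
    (∃ x ∈ d.2.2.2.2.2, x = (finN d w).2.1))

section
open Primrec
lemma finN_prim : Primrec fun x : List Bool × Desc => finN x.2 x.1 := by
  have n1 : Primrec fun x : List Bool × Desc => x.2.1.2.1 := fst.comp (snd.comp (fst.comp snd))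
  have n2 : Primrec fun x : List Bool × Desc => x.2.1.2.2 := snd.comp (snd.comp (fst.comp snd))
  have i1 : Primrec fun x : List Bool × Desc => x.2.2.2.2.1.1 :=
    fst.comp (fst.comp (snd.comp (snd.comp (snd.comp snd))))
  have i2 : Primrec fun x : List Bool × Desc => x.2.2.2.2.1.2 :=
    snd.comp (fst.comp (snd.comp (snd.comp (snd.comp snd))))
  have len : Primrec fun x : List Bool × Desc => x.1.length := list_length.comp fst
  have len1 : Primrec fun x : List Bool × Desc => x.1.length + 1 := succ.comp len
  have len2 : Primrec fun x : List Bool × Desc => x.1.length + 2 := succ.comp len1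
  refine nat_iterate (f := fun x : List Bool × Desc => bndN x.2 x.1)
    (g := fun x => iniN x.2 x.1) (h := fun x s => sim x.2 x.1 s) ?_ ?_ ?_
  · exact nat_mul.comp (nat_mul.comp (succ.comp n1) len2) (nat_mul.comp (succ.comp n2) len2)
  · exact Primrec.pair (Primrec.pair (nat_mod.comp i1 (succ.comp n1)) (const 0))
      (Primrec.pair (nat_mod.comp i2 (succ.comp n2)) len1)
  · exact option_getD.comp (stepN_prim (snd.comp fst) (fst.comp fst) snd) snd

lemma AccN_prim : PrimrecRel AccN := by
  have f1 : Primrec fun x : List Bool × Desc => x.2.2.2.2.2.1 :=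
    fst.comp (snd.comp (snd.comp (snd.comp (snd.comp snd))))
  have f2 : Primrec fun x : List Bool × Desc => x.2.2.2.2.2.2 :=
    snd.comp (snd.comp (snd.comp (snd.comp (snd.comp snd))))
  refine PrimrecPred.and ?_ (PrimrecPred.or ?_ ?_)
  · exact Primrec.eq.comp (stepN_prim snd fst finN_prim) (const none)
  · exact (PrimrecRel.exists_mem_list Primrec.eq).comp f1 (fst.comp (fst.comp finN_prim))
  · exact (PrimrecRel.exists_mem_list Primrec.eq).comp f2 (fst.comp (snd.comp finN_prim))
end

lemma iterate_fixed {S : Type} (g : S → S) (x : S) (F : Finset S) (hx : x ∈ F)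
    (hg : ∀ s ∈ F, g s ∈ F) (N : ℕ) (hN : F.card ≤ N) (t : ℕ) (ht : g (g^[t] x) = g^[t] x) :
    g^[N] x = g^[t] x := by
  classical
  have hex : ∃ t, g (g^[t] x) = g^[t] x := ⟨t, ht⟩
  have hin : ∀ n, g^[n] x ∈ F := by
    intro n
    induction n with
    | zero => exact hx
    | succ n ih => rw [Function.iterate_succ_apply']; exact hg _ ih
  have hstay : ∀ t, g (g^[t] x) = g^[t] x → ∀ n, g^[n + t] x = g^[t] x := by
    intro t ht n
    induction n with
    | zero => simp
    | succ n ih => rw [Nat.add_right_comm, Function.iterate_succ_apply', ih, ht]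
  let t0 := Nat.find hex
  have h0 : g (g^[t0] x) = g^[t0] x := Nat.find_spec hex
  have hle : t0 ≤ t := Nat.find_min' hex ht
  have e1 : g^[t] x = g^[t0] x := by
    have := hstay t0 h0 (t - t0)
    rwa [Nat.sub_add_cancel hle] at this
  rw [e1]
  rcases Nat.lt_or_ge N t0 with hlt | hge
  · exfalso
    obtain ⟨a, ha, b, hb, hab, he⟩ := Finset.exists_ne_map_eq_of_card_lt_of_maps_to
      (s := Finset.range (N + 1)) (t := F) (f := fun n => g^[n] x) (by simp; omega)
      (fun n _ => hin n)
    simp only [Finset.mem_range] at ha hb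
    have key : ∀ a b, a < b → b < N + 1 → g^[a] x = g^[b] x → False := by
      intro a b hab hb he
      have h1 : g^[(t0 - b) + a] x = g^[t0] x := by
        rw [Function.iterate_add_apply, he, ← Function.iterate_add_apply, Nat.sub_add_cancel (by omega)]
      exact Nat.find_min hex (m := (t0 - b) + a) (by omega) (by rw [h1]; exact h0)
    rcases Nat.lt_or_gt_of_ne hab with h | h
    · exact key a b h hb he
    · exact key b a h ha he.symm
  · have := hstay t0 h0 (N - t0)
    rwa [Nat.sub_add_cancel hge] at this

def cl (d : Desc) (w : List Bool) (c : Config (toDPWK d)) : St :=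
  (((show Fin (d.1.2.1 + 1) from c.p).val, min c.i (w.length + 1)),
    ((show Fin (d.1.2.2 + 1) from c.q).val, c.j))

lemma tape_min (w : List Bool) (i : ℕ) : tape w (min i (w.length + 1)) = tape w i := by
  rcases Nat.le_total i (w.length + 1) with h | h
  · rw [min_eq_left h]
  · rw [min_eq_right h, tape_end w i h, tape_end w _ le_rfl]

lemma δ1_eq (d : Desc) (w : List Bool) (c : Config (toDPWK d)) :
    (toDPWK d).δ1 c.p (tape w c.i) ((toDPWK d).μ2 c.q (tape w c.j)) =
      (e1 d w (cl d w c)).map fun e => (toFin d.1.2.1 e.1, e.2) := by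
  simp only [e1, cl, tIdx_eq, tape_min, muN_eq]
  rfl

lemma δ2_eq (d : Desc) (w : List Bool) (c : Config (toDPWK d)) :
    (toDPWK d).δ2 c.q (tape w c.j) ((toDPWK d).μ1 c.p (tape w c.i)) =
      (e2 d w (cl d w c)).map fun e => (toFin d.1.2.2 e.1, e.2) := by
  simp only [e2, cl, tIdx_eq, tape_min, muN_eq]
  rfl

lemma fin_eq (d : Desc) (w : List Bool) (s : St) (a b : ℕ × Bool)
    (h : ¬ (b.2 = true ∧ s.2.2 = 0)) : fin d w s a b =
    some ((a.1 % (d.1.2.1 + 1), min (s.1.2 + cond a.2 1 0) (w.length + 1)),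
      (b.1 % (d.1.2.2 + 1), s.2.2 - cond b.2 1 0)) := if_neg h

lemma step_cl {d : Desc} {w : List Bool} {c c' : Config (toDPWK d)} (h : Step (toDPWK d) w c c') :
    stepN d w (cl d w c) = some (cl d w c') := by
  obtain ⟨d1, d2, a1, a2, a3, a4⟩ := h
  obtain ⟨x, hx, hx'⟩ := Option.map_eq_some_iff.1 ((δ1_eq d w c).symm.trans a1)
  obtain ⟨y, hy, hy'⟩ := Option.map_eq_some_iff.1 ((δ2_eq d w c).symm.trans a2)
  rw [stepN, hx, hy]
  rcases c' with ⟨p, i, q, j⟩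
  rcases x with ⟨x, d1'⟩
  rcases y with ⟨y, d2'⟩
  simp only at a3 a4
  cases hx'
  cases hy'
  clear a1 a2
  have a3' : i = c.i + cond d1' 1 0 := a3
  have a4' : c.j = j + cond d2' 1 0 := a4
  refine (fin_eq d w _ _ _ ?_).trans ?_
  · rintro ⟨h1, h2⟩
    have h1' : d2' = true := h1
    have h2' : c.j = 0 := h2
    subst h1'
    simp only [cond_true] at a4'
    omega
  · refine congrArg some (Prod.ext (Prod.ext rfl ?_) (Prod.ext rfl ?_))
    · show min (min c.i (w.length + 1) + cond d1' 1 0) (w.length + 1) = min i (w.length + 1)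
      omega
    · show c.j - cond d2' 1 0 = j
      omega

lemma step_cl_exists {d : Desc} {w : List Bool} {c : Config (toDPWK d)} {s}
    (h : stepN d w (cl d w c) = some s) : ∃ c', Step (toDPWK d) w c c' := by
  simp only [stepN, Option.bind_eq_some_iff] at h
  obtain ⟨x, hx, y, hy, hf⟩ := h
  simp only [fin] at hf
  split_ifs at hf with hn
  refine ⟨⟨toFin d.1.2.1 x.1, c.i + cond x.2 1 0, toFin d.1.2.2 y.1, c.j - cond y.2 1 0⟩,
    x.2, y.2, ?_, ?_, rfl, ?_⟩
  · rw [δ1_eq, hx]; rfl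
  · rw [δ2_eq, hy]; rfl
  · have hn' : ¬ (y.2 = true ∧ c.j = 0) := hn
    show c.j = c.j - cond y.2 1 0 + cond y.2 1 0
    cases hy2 : y.2
    · simp
    · simp only [hy2, true_and] at hn'
      simp only [cond_true]
      omega

lemma sim_run (d : Desc) (w : List Bool) (t : ℕ) : ∃ ls c, SRun w (initConf (toDPWK d) w) ls c ∧
    (sim d w)^[t] (iniN d w) = cl d w c := by
  induction t with
  | zero =>
    refine ⟨[], _, SRun.nil _, ?_⟩
    simp only [Function.iterate_zero, id, cl]
    refine Prod.ext (Prod.ext rfl ?_) (Prod.ext rfl rfl)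
    simp [iniN, initConf]
  | succ t ih =>
    obtain ⟨ls, c, h1, h2⟩ := ih
    rw [Function.iterate_succ_apply', h2]
    by_cases h : ∃ c', Step (toDPWK d) w c c'
    · obtain ⟨c', hc'⟩ := h
      exact ⟨_, c', h1.append (SRun.cons hc' (SRun.nil _)), by simp [sim, step_cl hc']⟩
    · refine ⟨ls, c, h1, ?_⟩
      cases hs : stepN d w (cl d w c) with
      | none => simp [sim, hs]
      | some s => exact absurd (step_cl_exists hs) h

lemma run_sim {d : Desc} {w : List Bool} {c e : Config (toDPWK d)} {ls} (h : SRun w c ls e) :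
    (sim d w)^[ls.length] (cl d w c) = cl d w e := by
  induction h with
  | nil c => rfl
  | cons hs _ ih =>
    rw [List.length_cons, Function.iterate_succ_apply]
    simpa [sim, step_cl hs] using ih

lemma cl_start (d : Desc) (w : List Bool) : cl d w (initConf (toDPWK d) w) = iniN d w := by
  refine Prod.ext (Prod.ext rfl ?_) (Prod.ext rfl rfl)
  simp [cl, iniN, initConf]

def box (d : Desc) (w : List Bool) : Finset St :=
  (Finset.range (d.1.2.1 + 1) ×ˢ Finset.range (w.length + 2)) ×ˢ
    (Finset.range (d.1.2.2 + 1) ×ˢ Finset.range (w.length + 2))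

lemma box_sim (d : Desc) (w : List Bool) (s : St) (hs : s ∈ box d w) : sim d w s ∈ box d w := by
  unfold sim
  cases h : stepN d w s with
  | none => exact hs
  | some s' =>
    simp only [stepN, Option.bind_eq_some_iff] at h
    obtain ⟨x, _, y, _, hf⟩ := h
    simp only [fin] at hf
    split_ifs at hf
    cases hf
    simp only [box, Finset.mem_product, Finset.mem_range, Option.getD_some] at hs ⊢
    refine ⟨⟨Nat.mod_lt _ (by omega), by omega⟩, Nat.mod_lt _ (by omega), by omega⟩

lemma mem_AccN (d : Desc) (w : List Bool) : w ∈ lang (toDPWK d) ↔ AccN w d := by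
  rw [mem_lang]
  constructor
  · rintro ⟨ls, c, h1, h2, h3⟩
    have hn : stepN d w (cl d w c) = none := by
      cases hs : stepN d w (cl d w c) with
      | none => rfl
      | some s => exact absurd (step_cl_exists hs) h2
    have h4 := run_sim h1
    rw [cl_start] at h4
    have h5 : finN d w = cl d w c := by
      rw [← h4]
      apply iterate_fixed _ _ (box d w) _ (box_sim d w)
      · simp [box, bndN]
      · rw [h4]; simp [sim, hn]
      · simp only [box, iniN, Finset.mem_product, Finset.mem_range]
        exact ⟨⟨Nat.mod_lt _ (by omega), by omega⟩, Nat.mod_lt _ (by omega), by omega⟩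
    refine ⟨by rw [h5]; exact hn, ?_⟩
    rw [h5]
    rcases h3 with h3 | h3
    · exact Or.inl ⟨_, h3, rfl⟩
    · exact Or.inr ⟨_, h3, rfl⟩
  · rintro ⟨h1, h2⟩
    obtain ⟨ls, c, h3, h4⟩ := sim_run d w (bndN d w)
    rw [finN, h4] at h1 h2
    refine ⟨ls, c, h3, ?_, ?_⟩
    · rintro ⟨c', hc'⟩
      rw [step_cl hc'] at h1
      cases h1
    · rcases h2 with ⟨x, hx, rfl⟩ | ⟨x, hx, rfl⟩
      · exact Or.inl hx
      · exact Or.inr hx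

end
end WKP

namespace WKP
open WK

section
open Primrec

lemma Bd_prim (D : ℕ) : Primrec (Bd D) := by
  induction D with
  | zero => exact (Primrec.const 1).of_eq fun n => by simp [Bd]
  | succ D ih =>
    have h1 : Primrec fun W => 2 * (W * Bd D W) + 1 :=
      succ.comp (nat_mul.comp (const 2) (nat_mul.comp .id ih))
    exact (nat_mul.comp h1 ih).of_eq fun n => by simp [Bd]

lemma GB_prim (D c : ℕ) : Primrec fun N => GB D N c := by
  have h : Primrec fun N : ℕ => (N + 2) * (N + 2) :=
    nat_mul.comp (succ.comp (succ.comp .id)) (succ.comp (succ.comp .id))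
  exact nat_mul.comp h ((Bd_prim D).comp (nat_mul.comp (const c) h))

lemma BB_prim {X : Type} [Primcodable X] (K : ℕ) {a b a' b' : X → ℕ} (ha : Primrec a)
    (hb : Primrec b) (ha' : Primrec a') (hb' : Primrec b') :
    Primrec fun x => BB K (a x) (b x) (a' x) (b' x) := by
  have aux : ∀ {f : X → ℕ}, Primrec f → Primrec fun x => f x * (K + 1) + 1 := fun hf =>
    succ.comp (nat_mul.comp hf (const _))
  exact (GB_prim _ _).comp (nat_mul.comp (const 4) (nat_mul.comp (nat_mul.comp (aux ha) (aux hb))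
    (nat_mul.comp (aux ha') (aux hb'))))

def ws : ℕ → List (List Bool)
  | 0 => [[]]
  | n + 1 => [] :: (ws n).flatMap fun w => [false :: w, true :: w]

lemma mem_ws (n : ℕ) (w : List Bool) : w ∈ ws n ↔ w.length ≤ n := by
  induction n generalizing w with
  | zero => simp [ws]
  | succ n ih =>
    cases w with
    | nil => simp [ws]
    | cons b w => cases b <;> simp [ws, ih]

lemma ws_prim : Primrec ws := by
  have : Primrec fun n : ℕ => (Nat.rec [[]]
      (fun _ l => [] :: l.flatMap fun w => [false :: w, true :: w]) n : List (List Bool)) := by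
    refine nat_rec₁ _ ?_
    refine list_cons.comp (const []) (list_flatMap snd ?_)
    exact list_cons.comp (list_cons.comp (const false) snd)
      (list_cons.comp (list_cons.comp (const true) snd) (const []))
  refine this.of_eq fun n => ?_
  induction n with
  | zero => rfl
  | succ n ih => simp only [ws, ← ih]

lemma all_prim {X : Type} [Primcodable X] {R : List Bool → X → Prop} (hR : PrimrecRel R)
    {B : X → ℕ} (hB : Primrec B) : PrimrecPred fun x => ∀ w : List Bool, w.length ≤ B x → R w x := by
  refine ((PrimrecRel.forall_mem_list hR).comp (ws_prim.comp hB) .id).of_eq fun x => ?_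
  simp [mem_ws]

lemma to_fun {X : Type} [Primcodable X] {P : X → Prop} (h : PrimrecPred P) :
    ∃ f : ℕ → Bool, Computable f ∧ ∀ x, f (Encodable.encode x) = true ↔ P x := by
  obtain ⟨_, h⟩ := h
  refine ⟨fun n => ((Encodable.decode n : Option X).map fun x => decide (P x)).getD false, ?_, ?_⟩
  · exact (option_getD.comp (option_map Primrec.decode (h.comp snd).to₂) (const false)).to_comp
  · intro x; simp

lemma to_fun2 {X : Type} [Primcodable X] {P : X × X → Prop} (h : PrimrecPred P) :
    ∃ f : ℕ × ℕ → Bool, Computable f ∧ ∀ x y,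
      f (Encodable.encode x, Encodable.encode y) = true ↔ P (x, y) := by
  obtain ⟨f, h1, h2⟩ := to_fun h
  refine ⟨fun p => f (Nat.pair p.1 p.2), h1.comp (Primrec₂.natPair.comp fst snd).to_comp, ?_⟩
  intro x y
  rw [← h2, Encodable.encode_prod_val]

end

lemma RevCommBounded.comm {A : DPWK Bool} {k : ℕ} (h : RevCommBounded A (fun _ => k)) :
    CommBounded A (fun _ => k) := by
  obtain ⟨W, h⟩ := h
  intro w hw
  obtain ⟨cs, h1, h2, _⟩ := h w hw
  exact ⟨cs, h1, h2⟩

def s1 (d : Desc) : ℕ := d.1.2.1 + 1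
def s2 (d : Desc) : ℕ := d.1.2.2 + 1

lemma s1_prim : Primrec s1 := Primrec.succ.comp (Primrec.fst.comp (Primrec.snd.comp Primrec.fst))
lemma s2_prim : Primrec s2 := Primrec.succ.comp (Primrec.snd.comp (Primrec.snd.comp Primrec.fst))

lemma card1 (d : Desc) : Nat.card (toDPWK d).Q1 = s1 d := Nat.card_fin _
lemma card2 (d : Desc) : Nat.card (toDPWK d).Q2 = s2 d := Nat.card_fin _

def BD (k : ℕ) (d : Desc) : ℕ := BB (k + 1) (s1 d) (s2 d) (s1 d) (s2 d)
lemma BD_prim (k : ℕ) : Primrec (BD k) := BB_prim _ s1_prim s2_prim s1_prim s2_prim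

def Emp (k : ℕ) (d : Desc) : Prop := ∀ w : List Bool, w.length ≤ BD k d → ¬ AccN w d
def Fin' (k : ℕ) (d : Desc) : Prop := ∀ w : List Bool, w.length ≤ 2 * BD k d →
  ¬ (BD k d < w.length + 1 ∧ AccN w d)
def Inc (k : ℕ) (p : Desc × Desc) : Prop :=
  ∀ w : List Bool, w.length ≤ BB (k + 1) (s1 p.1) (s2 p.1) (s1 p.2) (s2 p.2) →
    ¬ (AccN w p.1 ∧ ¬ AccN w p.2)

section
open Primrec
lemma Emp_prim (k : ℕ) : PrimrecPred (Emp k) := all_prim AccN_prim.not (BD_prim k)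
lemma Fin'_prim (k : ℕ) : PrimrecPred (Fin' k) :=
  all_prim (R := fun w d => ¬ (BD k d < w.length + 1 ∧ AccN w d))
    (PrimrecPred.not (PrimrecPred.and (nat_lt.comp ((BD_prim k).comp snd)
    (succ.comp (list_length.comp fst))) AccN_prim)) (nat_mul.comp (const 2) (BD_prim k))
lemma Inc_prim (k : ℕ) : PrimrecPred (Inc k) :=
  all_prim (R := fun w (p : Desc × Desc) => ¬ (AccN w p.1 ∧ ¬ AccN w p.2))
    (PrimrecPred.not (PrimrecPred.and (AccN_prim.comp fst (fst.comp snd))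
    (PrimrecPred.not (AccN_prim.comp fst (snd.comp snd)))))
    (BB_prim _ (s1_prim.comp fst) (s2_prim.comp fst) (s1_prim.comp snd) (s2_prim.comp snd))
end

lemma Emp_iff {k : ℕ} {d : Desc} (h : CommBounded (toDPWK d) (fun _ => k)) :
    Emp k d ↔ lang (toDPWK d) = ∅ := by
  rw [small_empty _ k h _ _ (card1 d) (card2 d)]
  simp only [Emp, BD, mem_AccN]

lemma Fin'_iff {k : ℕ} {d : Desc} (h : CommBounded (toDPWK d) (fun _ => k)) :
    Fin' k d ↔ (lang (toDPWK d)).Finite := by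
  rw [small_fin _ k h _ _ (card1 d) (card2 d)]
  simp only [Fin', BD, mem_AccN, not_and]

lemma Inc_iff {k : ℕ} {d d' : Desc} (h : CommBounded (toDPWK d) (fun _ => k))
    (h' : CommBounded (toDPWK d') (fun _ => k)) :
    Inc k (d, d') ↔ lang (toDPWK d) ⊆ lang (toDPWK d') := by
  rw [small_diff _ _ k h h' _ _ _ _ (card1 d) (card2 d) (card1 d') (card2 d')]
  simp only [Inc, mem_AccN, not_and, not_not]

end WKP


open WK Encodable in
/-- For every constant `k`, emptiness, finiteness, inclusion and
equivalence are decidable for reversible deterministic two-party Watson-Crick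
systems that send at most `k` messages: there are computable functions on codes
of system descriptions deciding these questions for all described systems that are
reversible and communication bounded by `k`. -/
theorem REV_PWK_const_comm_decidable (k : ℕ) :
    (∃ f : ℕ → Bool, Computable f ∧ ∀ d : Desc,
      RevCommBounded (toDPWK d) (fun _ => k) →
        (f (encode d) = true ↔ lang (toDPWK d) = ∅)) ∧
    (∃ f : ℕ → Bool, Computable f ∧ ∀ d : Desc,
      RevCommBounded (toDPWK d) (fun _ => k) →
        (f (encode d) = true ↔ (lang (toDPWK d)).Finite)) ∧
    (∃ f : ℕ × ℕ → Bool, Computable f ∧ ∀ d d' : Desc,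
      RevCommBounded (toDPWK d) (fun _ => k) →
      RevCommBounded (toDPWK d') (fun _ => k) →
        (f (encode d, encode d') = true ↔ lang (toDPWK d) ⊆ lang (toDPWK d'))) ∧
    (∃ f : ℕ × ℕ → Bool, Computable f ∧ ∀ d d' : Desc,
      RevCommBounded (toDPWK d) (fun _ => k) →
      RevCommBounded (toDPWK d') (fun _ => k) →
        (f (encode d, encode d') = true ↔ lang (toDPWK d) = lang (toDPWK d'))) := by
  refine ⟨?_, ?_, ?_, ?_⟩
  · obtain ⟨f, h1, h2⟩ := WKP.to_fun (WKP.Emp_prim k)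
    exact ⟨f, h1, fun d hd => (h2 d).trans (WKP.Emp_iff (WKP.RevCommBounded.comm hd))⟩
  · obtain ⟨f, h1, h2⟩ := WKP.to_fun (WKP.Fin'_prim k)
    exact ⟨f, h1, fun d hd => (h2 d).trans (WKP.Fin'_iff (WKP.RevCommBounded.comm hd))⟩
  · obtain ⟨f, h1, h2⟩ := WKP.to_fun2 (WKP.Inc_prim k)
    exact ⟨f, h1, fun d d' hd hd' => (h2 d d').trans
      (WKP.Inc_iff (WKP.RevCommBounded.comm hd) (WKP.RevCommBounded.comm hd'))⟩
  · obtain ⟨f, h1, h2⟩ := WKP.to_fun2 ((WKP.Inc_prim k).and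
      ((WKP.Inc_prim k).comp (Primrec.pair Primrec.snd Primrec.fst)))
    refine ⟨f, h1, fun d d' hd hd' => (h2 d d').trans ?_⟩
    rw [WKP.Inc_iff (WKP.RevCommBounded.comm hd) (WKP.RevCommBounded.comm hd'),
      WKP.Inc_iff (WKP.RevCommBounded.comm hd') (WKP.RevCommBounded.comm hd)]
    exact Set.Subset.antisymm_iff.symm
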